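/- arXiv:math/0101050 — 3 statements merged into one kernel-verified Lean document; each statement's English description precedes it below -/
import Mathlib

section
/- Let n ≥ 10 be an even integer and let F be a field of characteristic 0. Then every nontrivial finite-dimensional representation of the alternating group A_n over F has dimension at least n - 1. (In particular, writing n = 2g + 2, every nontrivial representation of A_n in characteristic 0 has dimension strictly greater than 2g.) -/
/-- Elements `t`, `y`, `t * y` of a Klein four-group, permuted cyclically by conjugation by `s`. -/
structure KleinTriple {M : Type*} [Monoid M] (t y s : M) : Prop where
  t_sq : t * t = 1
  comm : t * y = y * t
  s_cube : s * s * s = 1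
  s_t : s * t = y * s
  s_y : s * y = t * y * s

namespace KleinTriple

theorem map {M N : Type*} [Monoid M] [Monoid N] {t y s : M} (h : KleinTriple t y s)
    (f : M →* N) : KleinTriple (f t) (f y) (f s) where
  t_sq := by rw [← map_mul, h.t_sq, map_one]
  comm := by rw [← map_mul, h.comm, map_mul]
  s_cube := by rw [← map_mul, ← map_mul, h.s_cube, map_one]
  s_t := by rw [← map_mul, h.s_t, map_mul]
  s_y := by rw [← map_mul, ← map_mul, h.s_y, map_mul, map_mul]

variable {F V : Type*} [Field F] [AddCommGroup V] [Module F V] {T Y S : Module.End F V}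

/-- The common eigenspace of `T` and `Y` with eigenvalues `1` and `-1`. -/
def weightSpace (T Y : Module.End F V) : Submodule F V where
  carrier := {v | T v = v ∧ Y v = -v}
  add_mem' := by
    rintro a b ⟨ha, ha'⟩ ⟨hb, hb'⟩
    exact ⟨by rw [map_add, ha, hb], by rw [map_add, ha', hb', neg_add]⟩
  zero_mem' := by simp
  smul_mem' := by
    rintro c a ⟨ha, ha'⟩
    exact ⟨by rw [map_smul, ha], by rw [map_smul, ha', smul_neg]⟩

theorem t_t (h : KleinTriple T Y S) (v : V) : T (T v) = v := LinearMap.congr_fun h.t_sq v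

theorem t_y (h : KleinTriple T Y S) (v : V) : T (Y v) = Y (T v) := LinearMap.congr_fun h.comm v

theorem s_s_s (h : KleinTriple T Y S) (v : V) : S (S (S v)) = v := LinearMap.congr_fun h.s_cube v

theorem s_t_apply (h : KleinTriple T Y S) (v : V) : S (T v) = Y (S v) :=
  LinearMap.congr_fun h.s_t v

theorem s_y_apply (h : KleinTriple T Y S) (v : V) : S (Y v) = T (Y (S v)) :=
  LinearMap.congr_fun h.s_y v

theorem injective_s (h : KleinTriple T Y S) : Function.Injective S := fun a b hab => by
  rw [← h.s_s_s a, hab, h.s_s_s]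

theorem y_y (h : KleinTriple T Y S) (v : V) : Y (Y v) = v := by
  rw [← h.s_s_s v, ← h.s_t_apply, ← h.s_t_apply, h.t_t]

theorem t_s (h : KleinTriple T Y S) {v : V} (hv : v ∈ weightSpace T Y) : T (S v) = -S v := by
  rw [← map_neg, ← hv.2, h.s_y_apply, ← h.s_t_apply, hv.1]

theorem t_s_s (h : KleinTriple T Y S) {v : V} (hv : v ∈ weightSpace T Y) :
    T (S (S v)) = -S (S v) := by
  have h1 : Y (S v) = S v := by rw [← h.s_t_apply, hv.1]
  have h2 : Y (S (S v)) = -S (S v) := by rw [← h.s_t_apply, h.t_s hv, map_neg]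
  have h3 : T (Y (S (S v))) = S (S v) := by rw [← h.s_y_apply, h1]
  rw [h2, map_neg] at h3
  rw [← h3, neg_neg, h3]

/-- The sum of the three conjugate common eigenspaces. -/
def sumMap (T Y S : Module.End F V) :
    weightSpace T Y × weightSpace T Y × weightSpace T Y →ₗ[F] V :=
  (weightSpace T Y).subtype.coprod
    ((S ∘ₗ (weightSpace T Y).subtype).coprod (S ∘ₗ S ∘ₗ (weightSpace T Y).subtype))

theorem sumMap_apply (x y z : weightSpace T Y) :
    sumMap T Y S (x, y, z) = (x : V) + (S y + S (S z)) := rfl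

theorem s_mem_weightSpace (h : KleinTriple T Y S) {v : V} (hT : T v = -v) (hY : Y v = -v) :
    S v ∈ weightSpace T Y := by
  have h1 : Y (S v) = -S v := by rw [← h.s_t_apply, hT, map_neg]
  have h2 := h.s_y_apply v
  rw [h1, hY, map_neg, map_neg, neg_inj] at h2
  exact ⟨h2.symm, h1⟩

theorem s_s_mem_weightSpace (h : KleinTriple T Y S) {v : V} (hT : T v = -v) (hY : Y v = v) :
    S (S v) ∈ weightSpace T Y := by
  have h1 : Y (S v) = -S v := by rw [← h.s_t_apply, hT, map_neg]
  have h2 := h.s_y_apply v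
  rw [h1, hY, map_neg] at h2
  exact h.s_mem_weightSpace (by rw [h2, neg_neg, ← h2]) h1

theorem map_mem_weightSpace {g : Module.End F V} (hT : Commute g T) (hY : Commute g Y) {v : V}
    (hv : v ∈ weightSpace T Y) : g v ∈ weightSpace T Y := by
  constructor
  · rw [← Module.End.mul_apply, ← hT.eq, Module.End.mul_apply, hv.1]
  · rw [← Module.End.mul_apply, ← hY.eq, Module.End.mul_apply, hv.2, map_neg]

theorem restrict {T' Y' S' : Module.End F V} (h' : KleinTriple T' Y' S') {K : Submodule F V}
    (hT : ∀ v ∈ K, T' v ∈ K) (hY : ∀ v ∈ K, Y' v ∈ K) (hS : ∀ v ∈ K, S' v ∈ K) :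
    KleinTriple (T'.restrict hT) (Y'.restrict hY) (S'.restrict hS) where
  t_sq := LinearMap.ext fun v => Subtype.ext (h'.t_t v)
  comm := LinearMap.ext fun v => Subtype.ext (h'.t_y v)
  s_cube := LinearMap.ext fun v => Subtype.ext (h'.s_s_s v)
  s_t := LinearMap.ext fun v => Subtype.ext (h'.s_t_apply v)
  s_y := LinearMap.ext fun v => Subtype.ext (h'.s_y_apply v)

variable [CharZero F]

theorem eq_zero_of_add_eq_zero (h : KleinTriple T Y S) {x y z : V} (hx : x ∈ weightSpace T Y)
    (hy : y ∈ weightSpace T Y) (hz : z ∈ weightSpace T Y) (h0 : x + (S y + S (S z)) = 0) :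
    x = 0 := by
  have h1 := congrArg T h0
  rw [map_add, map_add, hx.1, h.t_s hy, h.t_s_s hz, map_zero] at h1
  have h2 : (2 : F) • x = 0 := by
    rw [two_smul, ← add_zero (0 : V)]
    nth_rw 1 [← h0]
    rw [← h1]
    abel
  exact (smul_eq_zero.mp h2).resolve_left two_ne_zero

theorem injective_sumMap (h : KleinTriple T Y S) : Function.Injective (sumMap T Y S) := by
  rw [injective_iff_map_eq_zero]
  rintro ⟨x, y, z⟩ h0
  rw [sumMap_apply] at h0
  have hx : x = 0 := Subtype.ext (h.eq_zero_of_add_eq_zero x.2 y.2 z.2 h0)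
  subst hx
  have h1 : (y : V) + (S z + S (S (0 : V))) = 0 := by
    apply h.injective_s
    simpa using h0
  have hy : y = 0 := Subtype.ext (h.eq_zero_of_add_eq_zero y.2 z.2 (Submodule.zero_mem _) h1)
  subst hy
  have hz : z = 0 := by
    apply Subtype.ext
    apply h.injective_s
    simpa using h1
  rw [hz]
  rfl

theorem three_mul_finrank_le [FiniteDimensional F V] (h : KleinTriple T Y S) :
    3 * Module.finrank F (weightSpace T Y) ≤ Module.finrank F V := by
  have := LinearMap.finrank_le_finrank_of_injective h.injective_sumMap
  rw [Module.finrank_prod, Module.finrank_prod] at this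
  lia

theorem exists_sub_eq (h : KleinTriple T Y S) (u : V) :
    ∃ k ∈ weightSpace T Y, ∃ l ∈ weightSpace T Y, u - T u = S k + S (S l) := by
  set w := u - T u with hw
  have htw : T w = -w := by rw [hw, map_sub, h.t_t, neg_sub]
  refine ⟨S (S ((2⁻¹ : F) • (w + Y w))), h.s_s_mem_weightSpace ?_ ?_,
    S ((2⁻¹ : F) • (w - Y w)), h.s_mem_weightSpace ?_ ?_, ?_⟩
  · rw [map_smul, map_add, h.t_y, htw, map_neg, ← neg_add, smul_neg]
  · rw [map_smul, map_add, h.y_y, add_comm]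
  · rw [map_smul, map_sub, h.t_y, htw, map_neg, ← neg_sub', smul_neg]
  · rw [map_smul, map_sub, h.y_y, ← smul_neg, neg_sub]
  · rw [h.s_s_s, h.s_s_s, ← smul_add, add_add_sub_cancel, ← two_smul F w,
      inv_smul_smul₀ two_ne_zero]

theorem weightSpace_ne_bot (h : KleinTriple T Y S) (hT : T ≠ 1) : weightSpace T Y ≠ ⊥ := by
  intro hK
  apply hT
  ext u
  obtain ⟨k, hk, l, hl, e⟩ := h.exists_sub_eq u
  rw [hK, Submodule.mem_bot] at hk hl
  rw [hk, hl, map_zero, map_zero, add_zero, sub_eq_zero] at e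
  exact e.symm

theorem three_le_finrank [FiniteDimensional F V] (h : KleinTriple T Y S) (hT : T ≠ 1) :
    3 ≤ Module.finrank F V := by
  have h1 := Submodule.one_le_finrank_iff.mpr (h.weightSpace_ne_bot hT)
  have h2 := h.three_mul_finrank_le
  lia

theorem four_le_finrank [FiniteDimensional F V] (h : KleinTriple T Y S)
    {T' Y' S' : Module.End F V} (h' : KleinTriple T' Y' S') (hT : T ≠ 1) (hT' : T' ≠ 1)
    (hTT : Commute T' T) (hTY : Commute T' Y) (hTS : Commute T' S)
    (hYT : Commute Y' T) (hYY : Commute Y' Y) (hST : Commute S' T) (hSY : Commute S' Y) :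
    4 ≤ Module.finrank F V := by
  by_contra! hlt
  have h1 := Submodule.one_le_finrank_iff.mpr (h.weightSpace_ne_bot hT)
  have h3 := h.three_mul_finrank_le
  have hTK : ∀ v ∈ weightSpace T Y, T' v ∈ weightSpace T Y :=
    fun v hv => map_mem_weightSpace hTT hTY hv
  have hr := h'.restrict hTK (fun v hv => map_mem_weightSpace hYT hYY hv)
    (fun v hv => map_mem_weightSpace hST hSY hv)
  have hfix : ∀ v ∈ weightSpace T Y, T' v = v := by
    by_contra hne
    have := hr.three_le_finrank fun he => hne fun v hv =>
      congrArg Subtype.val (LinearMap.congr_fun he ⟨v, hv⟩)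
    lia
  have hsurj : Function.Surjective (sumMap T Y S) := by
    refine (LinearMap.injective_iff_surjective_of_finrank_eq_finrank ?_).mp h.injective_sumMap
    rw [Module.finrank_prod, Module.finrank_prod]
    lia
  have hS (v : V) : T' (S v) = S (T' v) := LinearMap.congr_fun hTS.eq v
  apply hT'
  ext u
  obtain ⟨⟨x, y, z⟩, rfl⟩ := hsurj u
  rw [sumMap_apply, Module.End.one_apply, map_add, map_add, hS, hS, hS, hfix _ x.2, hfix _ y.2,
    hfix _ z.2]

end KleinTriple

namespace alternatingGroup

open Equiv Equiv.Perm

variable {α : Type*} [Fintype α] [DecidableEq α]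

/-- The product of the transpositions `(a b)` and `(c d)`. -/
def doubleSwap {a b c d : α} (hab : a ≠ b) (hcd : c ≠ d) : alternatingGroup α :=
  ⟨swap a b * swap c d, by simp [mem_alternatingGroup, sign_swap hab, sign_swap hcd]⟩

variable {a b c d : α}

theorem coe_doubleSwap (hab : a ≠ b) (hcd : c ≠ d) :
    (doubleSwap hab hcd : Perm α) = swap a b * swap c d := rfl

theorem mul_doubleSwap (g : alternatingGroup α) (hab : a ≠ b) (hcd : c ≠ d) :
    g * doubleSwap hab hcd =
      doubleSwap ((g : Perm α).injective.ne hab) ((g : Perm α).injective.ne hcd) * g := by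
  apply Subtype.ext
  rw [Subgroup.coe_mul, Subgroup.coe_mul, coe_doubleSwap, coe_doubleSwap, swap_apply_apply,
    swap_apply_apply]
  group

theorem commute_doubleSwap {g : alternatingGroup α} (hab : a ≠ b) (hcd : c ≠ d)
    (ha : (g : Perm α) a = a) (hb : (g : Perm α) b = b) (hc : (g : Perm α) c = c)
    (hd : (g : Perm α) d = d) : Commute g (doubleSwap hab hcd) := by
  have := mul_doubleSwap g hab hcd
  simp only [ha, hb, hc, hd] at this
  exact this

theorem kleinTriple_doubleSwap (hab : a ≠ b) (hac : a ≠ c) (had : a ≠ d) (hbc : b ≠ c)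
    (hbd : b ≠ d) (hcd : c ≠ d) :
    KleinTriple (doubleSwap hab hcd) (doubleSwap hac hbd) (doubleSwap hbc hcd) := by
  constructor <;>
  · apply Subtype.ext
    ext x
    simp only [Subgroup.coe_mul, coe_doubleSwap, Subgroup.coe_one, Perm.mul_apply, Perm.one_apply,
      swap_apply_def]
    grind

theorem doubleSwap_ne_one (hab : a ≠ b) (hac : a ≠ c) (had : a ≠ d) (hcd : c ≠ d) :
    doubleSwap hab hcd ≠ 1 := by
  intro h
  have := congrArg (fun g : alternatingGroup α => (g : Perm α) a) h
  simp [coe_doubleSwap, swap_apply_of_ne_of_ne hac had] at this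
  exact hab this.symm

/-- Conjugating `(b j)(k l)` by `(a j)(k l)` gives `(a b)(k l)`. -/
theorem doubleSwap_mul_mul (hab : a ≠ b) {j k l : α} (haj : a ≠ j) (hbj : b ≠ j) (hkl : k ≠ l)
    (hk : k ∉ ({a, b, j} : Finset α)) (hl : l ∉ ({a, b, j} : Finset α)) :
    doubleSwap haj hkl * doubleSwap hbj hkl * doubleSwap haj hkl = doubleSwap hab hkl := by
  simp only [Finset.mem_insert, Finset.mem_singleton, not_or] at hk hl
  apply Subtype.ext
  ext x
  simp only [Subgroup.coe_mul, coe_doubleSwap, Perm.mul_apply, swap_apply_def]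
  grind

theorem doubleSwap_mul_doubleSwap (hab : a ≠ b) (hcd : c ≠ d) {k l : α} (hkl : k ≠ l)
    (hk : k ∉ ({c, d} : Finset α)) (hl : l ∉ ({c, d} : Finset α)) :
    doubleSwap hab hkl * doubleSwap hcd hkl = doubleSwap hab hcd := by
  simp only [Finset.mem_insert, Finset.mem_singleton, not_or] at hk hl
  apply Subtype.ext
  have : swap k l * swap c d = swap c d * swap k l := by
    rw [mul_swap_eq_swap_mul, swap_apply_of_ne_of_ne (Ne.symm hk.1) (Ne.symm hl.1),
      swap_apply_of_ne_of_ne (Ne.symm hk.2) (Ne.symm hl.2)]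
  rw [Subgroup.coe_mul, coe_doubleSwap, coe_doubleSwap, coe_doubleSwap, mul_assoc,
    ← mul_assoc (swap k l), this, mul_assoc, swap_mul_self, mul_one]

theorem support_doubleSwap_subset (hab : a ≠ b) (hcd : c ≠ d) {s : Finset α} (ha : a ∈ s)
    (hb : b ∈ s) (hc : c ∈ s) (hd : d ∈ s) : (doubleSwap hab hcd : Perm α).support ⊆ s := by
  intro x hx
  rw [mem_support, coe_doubleSwap, Perm.mul_apply, swap_apply_def, swap_apply_def] at hx
  grind

/-- A subgroup containing the three-cycles supported in `s` contains every even permutation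
supported in `s`. -/
theorem mem_of_isThreeCycle_mem (H : Subgroup (alternatingGroup α)) (s : Finset α)
    (hH : ∀ g : alternatingGroup α, (g : Perm α).IsThreeCycle → (g : Perm α).support ⊆ s → g ∈ H)
    {g : alternatingGroup α} (hg : (g : Perm α).support ⊆ s) : g ∈ H := by
  obtain ⟨g, rfl⟩ := (mem_range_ofSubtype_iff s g).mpr hg
  have : (⊤ : Subgroup (alternatingGroup s)) ≤ H.comap (ofSubtype s) := by
    rw [← closure_isThreeCycles_eq_top, Subgroup.closure_le]
    intro k hk
    refine hH _ ?_ ((mem_range_ofSubtype_iff s _).mp ⟨k, rfl⟩)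
    rw [coe_ofSubtype, IsThreeCycle, cycleType_ofSubtype]
    exact hk
  exact this (Subgroup.mem_top g)

section Representation

variable {F V : Type*} [Field F] [AddCommGroup V] [Module F V]
  (ρ : Representation F (alternatingGroup α) V)

theorem apply_ne_one (hα : 5 ≤ Nat.card α) (hρ : ρ ≠ 1) {g : alternatingGroup α} (hg : g ≠ 1) :
    ρ g ≠ 1 := by
  have : IsSimpleGroup (alternatingGroup α) := isSimpleGroup hα
  intro h
  rcases (MonoidHom.normal_ker ρ).eq_bot_or_eq_top with h1 | h1
  · have : g ∈ ρ.ker := h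
    rw [h1] at this
    exact hg this
  · exact hρ ((MonoidHom.ker_eq_top_iff).mp h1)

/-- The subgroup of elements fixing `v`. -/
def fixer (v : V) : Subgroup (alternatingGroup α) where
  carrier := {g | ρ g v = v}
  mul_mem' := by
    intro g h hg hh
    simp only [Set.mem_ofPred_eq] at *
    rw [map_mul, Module.End.mul_apply, hh, hg]
  one_mem' := by simp
  inv_mem' := by
    intro g hg
    simp only [Set.mem_ofPred_eq] at *
    nth_rw 1 [← hg]
    rw [← Module.End.mul_apply, ← map_mul, inv_mul_cancel, map_one, Module.End.one_apply]

theorem mem_fixer {v : V} {g : alternatingGroup α} : g ∈ fixer ρ v ↔ ρ g v = v := Iff.rfl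

/-- Every vector `u - (a b)(c d) u` is fixed by the even permutations fixing `a`, `b`, `c`, `d`. -/
def FixesDifferences : Prop :=
  ∀ ⦃a b c d : α⦄ (hab : a ≠ b) (_ : a ≠ c) (_ : a ≠ d) (_ : b ≠ c) (_ : b ≠ d) (hcd : c ≠ d)
    (g : alternatingGroup α), (g : Perm α).support ⊆ {a, b, c, d}ᶜ → ∀ u,
      ρ g (u - ρ (doubleSwap hab hcd) u) = u - ρ (doubleSwap hab hcd) u

theorem apply_eq_of_support_subset {g : Perm α} {s : Finset α} (hg : g.support ⊆ sᶜ) {x : α}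
    (hx : x ∈ s) : g x = x := by
  by_contra h
  exact Finset.mem_compl.mp (hg (mem_support.mpr h)) hx

/-- Given a double transposition whose four points are `s`, either the complement of `s` acts
trivially on the differences, or it acts nontrivially on a space of at most a third of the
dimension. -/
theorem fixes_or_exists [CharZero F] [FiniteDimensional F V] (hab : a ≠ b) (hac : a ≠ c)
    (had : a ≠ d) (hbc : b ≠ c) (hbd : b ≠ d) (hcd : c ≠ d) :
    (∀ g : alternatingGroup α, (g : Perm α).support ⊆ {a, b, c, d}ᶜ → ∀ u,
      ρ g (u - ρ (doubleSwap hab hcd) u) = u - ρ (doubleSwap hab hcd) u) ∨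
    ∃ (K : Submodule F V)
      (τ : Representation F (alternatingGroup ({a, b, c, d}ᶜ : Finset α)) K),
      τ ≠ 1 ∧ 3 * Module.finrank F K ≤ Module.finrank F V := by
  have hk := (kleinTriple_doubleSwap hab hac had hbc hbd hcd).map ρ
  have hcomm {x y z w : α} (hxy : x ≠ y) (hzw : z ≠ w) (hx : x ∈ ({a, b, c, d} : Finset α))
      (hy : y ∈ ({a, b, c, d} : Finset α)) (hz : z ∈ ({a, b, c, d} : Finset α))
      (hw : w ∈ ({a, b, c, d} : Finset α)) (g : alternatingGroup α)
      (hg : (g : Perm α).support ⊆ {a, b, c, d}ᶜ) :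
      Commute (ρ g) (ρ (doubleSwap hxy hzw)) :=
    (commute_doubleSwap hxy hzw (apply_eq_of_support_subset hg hx)
      (apply_eq_of_support_subset hg hy) (apply_eq_of_support_subset hg hz)
      (apply_eq_of_support_subset hg hw)).map ρ
  set K := KleinTriple.weightSpace (ρ (doubleSwap hab hcd)) (ρ (doubleSwap hac hbd)) with hK
  let ι := ofSubtype ({a, b, c, d}ᶜ : Finset α)
  have hι (g) : (ι g : Perm α).support ⊆ {a, b, c, d}ᶜ :=
    (mem_range_ofSubtype_iff _ _).mp ⟨g, rfl⟩
  let τ : Representation F (alternatingGroup ({a, b, c, d}ᶜ : Finset α)) K :=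
    Subrepresentation.toRepresentation (ρ := ρ.comp ι) ⟨K, fun g v hv =>
      KleinTriple.map_mem_weightSpace
        (hcomm hab hcd (by simp) (by simp) (by simp) (by simp) _ (hι g))
        (hcomm hac hbd (by simp) (by simp) (by simp) (by simp) _ (hι g)) hv⟩
  by_cases hτ : τ = 1
  · left
    intro g hg u
    have hfix : ∀ v ∈ K, ρ g v = v := by
      intro v hv
      obtain ⟨g, rfl⟩ := (mem_range_ofSubtype_iff _ g).mpr hg
      exact congrArg Subtype.val (LinearMap.congr_fun (DFunLike.congr_fun hτ g) ⟨v, hv⟩)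
    obtain ⟨k, hk, l, hl, e⟩ := hk.exists_sub_eq u
    have hS (v : V) : ρ g (ρ (doubleSwap hbc hcd) v) = ρ (doubleSwap hbc hcd) (ρ g v) :=
      LinearMap.congr_fun (hcomm hbc hcd (by simp) (by simp) (by simp) (by simp) g hg).eq v
    rw [e, map_add, hS, hS, hS, hfix k hk, hfix l hl]
  · exact Or.inr ⟨K, τ, hτ, hk.three_mul_finrank_le⟩

theorem exists_ne_notMem {s : Finset α} (hs : s.card + 2 ≤ Fintype.card α) :
    ∃ p q : α, p ≠ q ∧ p ∉ s ∧ q ∉ s := by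
  have : 1 < sᶜ.card := by rw [Finset.card_compl]; lia
  obtain ⟨p, hp, q, hq, hpq⟩ := Finset.one_lt_card.mp this
  exact ⟨p, q, hpq, Finset.mem_compl.mp hp, Finset.mem_compl.mp hq⟩

variable {ρ}

theorem FixesDifferences.sub_fixed (hρ : FixesDifferences ρ) (hα : 10 ≤ Fintype.card α)
    {v : V} {s : Finset α} (hs : s.card ≤ 4)
    (hv : ∀ g : alternatingGroup α, (g : Perm α).support ⊆ sᶜ → ρ g v = v)
    {i j k l : α} (hi : i ∈ s) (hk : k ∉ s) (hl : l ∉ s)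
    (hij : i ≠ j) (hkl : k ≠ l) {g : alternatingGroup α}
    (hg : (g : Perm α).support ⊆ {i, j}ᶜ) :
    ρ g (v - ρ (doubleSwap hij hkl) v) = v - ρ (doubleSwap hij hkl) v := by
  refine mem_of_isThreeCycle_mem (fixer ρ _) _ (fun g h3 hg => ?_) hg
  obtain ⟨p, q, hpq, hp, hq⟩ :=
    exists_ne_notMem (s := insert j s ∪ (g : Perm α).support) (by
      have h1 := Finset.card_union_le (insert j s) (g : Perm α).support
      have h2 := Finset.card_insert_le j s
      have h3 := h3.card_support
      lia)
  simp only [Finset.mem_union, Finset.mem_insert, not_or] at hp hq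
  obtain ⟨⟨hpj, hps⟩, hpg⟩ := hp
  obtain ⟨⟨hqj, hqs⟩, hqg⟩ := hq
  have hmul : doubleSwap hij hkl = doubleSwap hij hpq * doubleSwap hpq hkl := by
    apply Subtype.ext
    simp [coe_doubleSwap, mul_assoc]
  have hfix : ρ (doubleSwap hpq hkl) v = v :=
    hv _ (support_doubleSwap_subset hpq hkl (by simpa) (by simpa) (by simpa) (by simpa))
  rw [mem_fixer, hmul, map_mul, Module.End.mul_apply, hfix]
  refine hρ hij (by grind) (by grind) (by grind) (by grind) hpq g ?_ v
  intro x hx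
  have h1 := hg hx
  simp only [Finset.mem_compl, Finset.mem_insert, Finset.mem_singleton, not_or] at h1 ⊢
  exact ⟨h1.1, h1.2, fun h => hpg (h ▸ hx), fun h => hqg (h ▸ hx)⟩

theorem FixesDifferences.exists_fixed_pair_of_ne (hρ : FixesDifferences ρ)
    (hα : 10 ≤ Fintype.card α) {v : V} {s : Finset α} (hs : s.card ≤ 4)
    (hv : ∀ g : alternatingGroup α, (g : Perm α).support ⊆ sᶜ → ρ g v = v)
    {i j k l : α} (hi : i ∈ s) (hk : k ∉ s) (hl : l ∉ s) (hij : i ≠ j) (hjk : j ≠ k)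
    (hjl : j ≠ l) (hkl : k ≠ l) (hne : ρ (doubleSwap hij hkl) v ≠ v) :
    ∃ (i j : α) (w : V), w ≠ 0 ∧
      (∀ g : alternatingGroup α, (g : Perm α).support ⊆ {i, j}ᶜ → ρ g w = w) ∧
      ∃ t : alternatingGroup α, (t : Perm α) i = j ∧ (t : Perm α) j = i ∧ ρ t w = -w := by
  have hik : i ≠ k := ne_of_mem_of_not_mem hi hk
  have hil : i ≠ l := ne_of_mem_of_not_mem hi hl
  refine ⟨i, j, v - ρ (doubleSwap hij hkl) v, sub_ne_zero.mpr hne.symm,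
    fun g hg => hρ.sub_fixed hα hs hv hi hk hl hij hkl hg, doubleSwap hij hkl, ?_, ?_, ?_⟩
  · rw [coe_doubleSwap, Perm.mul_apply, swap_apply_of_ne_of_ne hik hil, swap_apply_left]
  · rw [coe_doubleSwap, Perm.mul_apply, swap_apply_of_ne_of_ne hjk hjl, swap_apply_right]
  · have : ρ (doubleSwap hij hkl) (ρ (doubleSwap hij hkl) v) = v :=
      ((kleinTriple_doubleSwap hij hik hil hjk hjl hkl).map ρ).t_t v
    rw [map_sub, this, neg_sub]

theorem FixesDifferences.exists_fixed_pair [CharZero F] (hρ : FixesDifferences ρ)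
    (hα : 10 ≤ Fintype.card α) (hne : ρ ≠ 1) :
    ∃ (i j : α) (w : V), w ≠ 0 ∧
      (∀ g : alternatingGroup α, (g : Perm α).support ⊆ {i, j}ᶜ → ρ g w = w) ∧
      ∃ t : alternatingGroup α, (t : Perm α) i = j ∧ (t : Perm α) j = i ∧ ρ t w = -w := by
  obtain ⟨a, b, hab, -, -⟩ := exists_ne_notMem (α := α) (s := ∅) (by simp; lia)
  obtain ⟨c, d, hcd, hc, hd⟩ := exists_ne_notMem (s := {a, b}) (by
    have := Finset.card_le_two (a := a) (b := b)
    lia)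
  obtain ⟨k, l, hkl, hk, hl⟩ := exists_ne_notMem (s := {a, b, c, d}) (by
    have := Finset.card_le_four (a := a) (b := b) (c := c) (d := d)
    lia)
  obtain ⟨j, -, -, hj, -⟩ := exists_ne_notMem (s := {a, b, c, d, k, l}) (by
    have := Finset.card_le_six (a := a) (b := b) (c := c) (d := d) (e := k) (f := l)
    lia)
  have hks := hk
  have hls := hl
  simp only [Finset.mem_insert, Finset.mem_singleton, not_or, ← ne_eq] at hc hd hk hl hj
  obtain ⟨hca, hcb⟩ := hc
  obtain ⟨hda, hdb⟩ := hd
  obtain ⟨hka, hkb, hkc, hkd⟩ := hk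
  obtain ⟨hla, hlb, hlc, hld⟩ := hl
  obtain ⟨hja, hjb, hjc, hjd, hjk, hjl⟩ := hj
  have ht : ρ (doubleSwap hab hcd) ≠ 1 :=
    apply_ne_one ρ (by rw [Nat.card_eq_fintype_card]; lia) hne
      (doubleSwap_ne_one hab hca.symm hda.symm hcd)
  obtain ⟨u, hu⟩ : ∃ u, ρ (doubleSwap hab hcd) u ≠ u := by
    by_contra! h
    exact ht (LinearMap.ext h)
  have hstar := fun g hg => hρ hab hca.symm hda.symm hcb.symm hdb.symm hcd g hg u
  have htt : ρ (doubleSwap hab hcd) (ρ (doubleSwap hab hcd) u) = u :=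
    ((kleinTriple_doubleSwap hab hca.symm hda.symm hcb.symm hdb.symm hcd).map ρ).t_t u
  set v := u - ρ (doubleSwap hab hcd) u with hv
  have hv0 : v ≠ 0 := sub_ne_zero.mpr hu.symm
  have htv : ρ (doubleSwap hab hcd) v = -v := by rw [hv, map_sub, htt, neg_sub]
  by_contra hcon
  have hmain {i : α} (hij : i ≠ j) (hi : i ∈ ({a, b, c, d} : Finset α)) :
      doubleSwap hij hkl ∈ fixer ρ v := by
    by_contra h
    exact hcon (hρ.exists_fixed_pair_of_ne hα Finset.card_le_four hstar hi hks hls hij hjk hjl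
      hkl h)
  have hfa := hmain hja.symm (by simp)
  have hfb := hmain hjb.symm (by simp)
  have hfc := hmain hjc.symm (by simp)
  have hfd := hmain hjd.symm (by simp)
  have hft : doubleSwap hab hcd ∈ fixer ρ v := by
    rw [← doubleSwap_mul_doubleSwap hab hcd hkl (by simp [hkc, hkd]) (by simp [hlc, hld]),
      ← doubleSwap_mul_mul hab hja.symm hjb.symm hkl (by simp [hka, hkb, hjk.symm])
        (by simp [hla, hlb, hjl.symm]),
      ← doubleSwap_mul_mul hcd hjc.symm hjd.symm hkl (by simp [hkc, hkd, hjk.symm])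
        (by simp [hlc, hld, hjl.symm])]
    exact mul_mem (mul_mem (mul_mem hfa hfb) hfa) (mul_mem (mul_mem hfc hfd) hfc)
  rw [mem_fixer, htv] at hft
  apply hv0
  have h2 : (2 : F) • v = 0 := by
    rw [two_smul]
    nth_rw 1 [← hft]
    exact neg_add_cancel v
  exact (smul_eq_zero.mp h2).resolve_left two_ne_zero

theorem FixesDifferences.cocycle [CharZero F] (hρ : FixesDifferences ρ)
    (hα : 10 ≤ Fintype.card α) {f : α → α → V}
    (hf : ∀ (g : alternatingGroup α) x y, ρ g (f x y) = f ((g : Perm α) x) ((g : Perm α) y))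
    (hf' : ∀ x y, f y x = -f x y) (x y z : α) : f x y + f y z = f x z := by
  have key {x z y y' : α} (hxz : x ≠ z) (hyx : y ≠ x) (hyz : y ≠ z) (hyx' : y' ≠ x)
      (hyz' : y' ≠ z) (hyy : y ≠ y') : f x y + f y z = f x y' + f y' z := by
    obtain ⟨p, q, hpq, hp, hq⟩ := exists_ne_notMem (s := {x, y, z, y'}) (by
      have := Finset.card_le_four (a := x) (b := y) (c := z) (d := y')
      lia)
    simp only [Finset.mem_insert, Finset.mem_singleton, not_or] at hp hq
    have h1 := hρ.sub_fixed hα (v := f x y) (s := {x, y}) (i := x) (j := z) (k := p) (l := q)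
      (Finset.card_le_two.trans (by norm_num)) (fun g hg => by
        rw [hf, apply_eq_of_support_subset hg (by simp), apply_eq_of_support_subset hg (by simp)])
      (by simp) (by grind) (by grind) hxz hpq (g := doubleSwap hyy hpq)
      (support_doubleSwap_subset hyy hpq (by simp [hyx, hyz]) (by simp [hyx', hyz'])
        (by simp [hp]) (by simp [hq]))
    have e1 : ρ (doubleSwap hxz hpq) (f x y) = f z y := by
      rw [hf]
      congr 1 <;>
      · rw [coe_doubleSwap, Perm.mul_apply, swap_apply_def, swap_apply_def]
        grind
    have e2 {r : α} (hr : r = x ∨ r = z) : ρ (doubleSwap hyy hpq) (f r y) = f r y' := by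
      rw [hf]
      congr 1 <;>
      · rw [coe_doubleSwap, Perm.mul_apply, swap_apply_def, swap_apply_def]
        grind
    rw [e1, map_sub, e2 (Or.inl rfl), e2 (Or.inr rfl)] at h1
    rw [hf' z y, hf' z y', ← sub_eq_add_neg, ← sub_eq_add_neg, h1]
  have hself (x : α) : f x x = 0 := by
    have h2 : (2 : F) • f x x = 0 := by
      rw [two_smul]
      nth_rw 1 [hf' x x]
      exact neg_add_cancel _
    exact (smul_eq_zero.mp h2).resolve_left two_ne_zero
  by_cases hxy : x = y
  · rw [hxy, hself, zero_add]
  by_cases hyz : y = z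
  · rw [hyz, hself, add_zero]
  by_cases hxz : x = z
  · rw [← hxz, hf' x y, add_neg_cancel, hself]
  obtain ⟨u, -, -, hu, -⟩ := exists_ne_notMem (s := {x, y, z}) (by
    have := Finset.card_le_three (a := x) (b := y) (c := z)
    lia)
  simp only [Finset.mem_insert, Finset.mem_singleton, not_or] at hu
  obtain ⟨hux, huy, huz⟩ := hu
  have h1 : f z x + f x y = f z u + f u y := key (by grind) (by grind) hxy huz huy (by grind)
  have h2 : f u y + f y z = f u x + f x z := key huz (by grind) hyz (by grind) hxz (by grind)
  have h3 : f z u + f u x = f z y + f y x := key (by grind) huz hux hyz (by grind) huy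
  rw [hf' x z] at h1
  rw [hf' y z, hf' x y] at h3
  have h2 : (2 : F) • (f x y + f y z - f x z) = 0 := by
    have h := congrArg₂ (· + ·) (congrArg₂ (· + ·) h1 h2) h3
    rw [← sub_eq_zero] at h
    rw [two_smul, ← h]
    abel
  exact sub_eq_zero.mp ((smul_eq_zero.mp h2).resolve_left two_ne_zero)

theorem card_le_finrank_add_one [FiniteDimensional F V] (hα : 7 ≤ Fintype.card α)
    {s : α → V} (hs : ∀ (g : alternatingGroup α) x, ρ g (s x) = s ((g : Perm α) x))
    {i j : α} (hij : s i ≠ s j) : Fintype.card α ≤ Module.finrank F V + 1 := by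
  set Φ := Fintype.linearCombination F s with hΦ
  have hinv {c : α → F} (hc : c ∈ LinearMap.ker Φ) (g : alternatingGroup α) :
      c ∘ (g : Perm α) ∈ LinearMap.ker Φ := by
    rw [LinearMap.mem_ker, Fintype.linearCombination_apply] at hc ⊢
    have := congrArg (ρ g⁻¹) hc
    rw [map_sum, map_zero] at this
    rw [← this]
    refine Fintype.sum_equiv (g : Perm α) _ _ fun x => ?_
    rw [map_smul, hs]
    simp
  have hstep {c : α → F} (hc : c ∈ LinearMap.ker Φ) {k l m : α} (hkl : k ≠ l) (hmk : m ≠ k)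
      (hml : m ≠ l) (hcc : c k ≠ c l) : s m = s l := by
    obtain ⟨p, q, hpq, hp, hq⟩ := exists_ne_notMem (s := {k, l, m}) (by
      have := Finset.card_le_three (a := k) (b := l) (c := m)
      lia)
    obtain ⟨u, v, huv, hu, hv⟩ := exists_ne_notMem (s := {k, l, m, p, q}) (by
      have := Finset.card_le_five (a := k) (b := l) (c := m) (d := p) (e := q)
      lia)
    simp only [Finset.mem_insert, Finset.mem_singleton, not_or] at hp hq hu hv
    have h1 := Submodule.sub_mem _ hc (hinv hc (doubleSwap hkl hpq))
    have h2 := Submodule.sub_mem _ h1 (hinv h1 (doubleSwap hml huv))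
    have h3 : c - c ∘ (doubleSwap hkl hpq : Perm α) -
        (c - c ∘ (doubleSwap hkl hpq : Perm α)) ∘ (doubleSwap hml huv : Perm α) =
        (c k - c l) • (Pi.single m 1 - Pi.single l 1) := by
      ext x
      simp only [Pi.sub_apply, Pi.smul_apply, Function.comp_apply, coe_doubleSwap, Perm.mul_apply,
        swap_apply_def, Pi.single_apply, smul_eq_mul]
      grind
    rw [h3, LinearMap.mem_ker, map_smul, map_sub, hΦ, Fintype.linearCombination_apply_single,
      Fintype.linearCombination_apply_single, one_smul, one_smul] at h2
    exact sub_eq_zero.mp ((smul_eq_zero.mp h2).resolve_left (sub_ne_zero.mpr hcc))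
  have hconst {c : α → F} (hc : c ∈ LinearMap.ker Φ) (k l : α) : c k = c l := by
    by_contra hcc
    have hkl : k ≠ l := fun h => hcc (h ▸ rfl)
    obtain ⟨m, -, -, hm, -⟩ := exists_ne_notMem (s := {k, l}) (by
      have := Finset.card_le_two (a := k) (b := l)
      lia)
    simp only [Finset.mem_insert, Finset.mem_singleton, not_or] at hm
    have h1 := hstep hc hkl hm.1 hm.2 hcc
    have h2 := hstep hc hkl.symm hm.2 hm.1 (Ne.symm hcc)
    have hall (x : α) : s x = s l := by
      by_cases hxl : x = l
      · rw [hxl]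
      by_cases hxk : x = k
      · rw [hxk, ← h2, h1]
      exact hstep hc hkl hxk hxl hcc
    exact hij ((hall i).trans (hall j).symm)
  have hker : LinearMap.ker Φ ≤ Submodule.span F {fun _ => 1} := by
    intro c hc
    rw [Submodule.mem_span_singleton]
    exact ⟨c i, funext fun x => by simp [hconst hc i x]⟩
  have h1 := (Submodule.finrank_mono hker).trans (finrank_span_le_card _)
  have h2 := LinearMap.finrank_range_add_finrank_ker Φ
  have h3 := Submodule.finrank_le (LinearMap.range Φ)
  rw [Module.finrank_fintype_fun_eq_card] at h2
  rw [Set.toFinset_singleton, Finset.card_singleton] at h1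
  lia


theorem FixesDifferences.card_le [CharZero F] [FiniteDimensional F V] (hρ : FixesDifferences ρ)
    (hα : 10 ≤ Fintype.card α) (hne : ρ ≠ 1) : Fintype.card α ≤ Module.finrank F V + 1 := by
  obtain ⟨i, j, w, hw, hfix, t, hti, htj, htw⟩ := hρ.exists_fixed_pair hα hne
  let f (x y : α) : V := ∑ g : alternatingGroup α,
    if (g : Perm α) i = x ∧ (g : Perm α) j = y then ρ g w else 0
  have hf (g : alternatingGroup α) (x y : α) :
      ρ g (f x y) = f ((g : Perm α) x) ((g : Perm α) y) := by
    rw [map_sum]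
    refine Fintype.sum_equiv (Equiv.mulLeft g) _ _ fun h => ?_
    rw [apply_ite (ρ g), map_zero]
    simp [Module.End.mul_apply]
  have hf' (x y : α) : f y x = -f x y := by
    rw [← Finset.sum_neg_distrib]
    refine Fintype.sum_equiv (Equiv.mulRight t) _ _ fun h => ?_
    simp only [Equiv.coe_mulRight, Subgroup.coe_mul, Perm.mul_apply, hti, htj, map_mul,
      Module.End.mul_apply, htw, map_neg]
    by_cases h1 : (h : Perm α) i = y <;> by_cases h2 : (h : Perm α) j = x <;> simp [h1, h2]
  have hcoc := hρ.cocycle hα hf hf'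
  have hij : f i j ≠ 0 := by
    have h1 : f i j = ∑ g : alternatingGroup α,
        if (g : Perm α) i = i ∧ (g : Perm α) j = j then w else 0 := by
      refine Finset.sum_congr rfl fun g _ => ?_
      split_ifs with h
      · refine hfix g fun x hx => ?_
        rw [mem_support] at hx
        simp only [Finset.mem_compl, Finset.mem_insert, Finset.mem_singleton, not_or]
        exact ⟨fun e => hx (e ▸ h.1), fun e => hx (e ▸ h.2)⟩
      · rfl
    rw [h1, ← Finset.sum_filter, Finset.sum_const, ← Nat.cast_smul_eq_nsmul F]
    refine smul_ne_zero (Nat.cast_ne_zero.mpr (Finset.card_ne_zero_of_mem (a := 1) ?_)) hw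
    simp
  refine card_le_finrank_add_one (ρ := ρ) (by lia) (s := fun x => ∑ y, f x y) (fun g x => ?_)
    (i := i) (j := j) fun hs => ?_
  · rw [map_sum]
    exact Fintype.sum_equiv (g : Perm α) _ _ fun y => hf g x y
  · have h1 : ∑ y, f i y = (Fintype.card α : F) • f i j + ∑ y, f j y := by
      rw [Nat.cast_smul_eq_nsmul, ← Finset.card_univ, ← Finset.sum_const,
        ← Finset.sum_add_distrib]
      exact Finset.sum_congr rfl fun y _ => (hcoc i j y).symm
    rw [hs, right_eq_add] at h1
    refine hij ((smul_eq_zero.mp h1).resolve_left (Nat.cast_ne_zero.mpr ?_))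
    lia

variable (ρ)

theorem three_le_finrank [CharZero F] [FiniteDimensional F V] (hα : 5 ≤ Fintype.card α)
    (hne : ρ ≠ 1) : 3 ≤ Module.finrank F V := by
  obtain ⟨e⟩ := Function.Embedding.nonempty_of_card_le (α := Fin 4) (β := α) (by simp; lia)
  have he {x y : Fin 4} (h : x ≠ y) : e x ≠ e y := e.injective.ne h
  have h01 : e 0 ≠ e 1 := he (by decide)
  have h23 : e 2 ≠ e 3 := he (by decide)
  exact ((kleinTriple_doubleSwap h01 (he (by decide)) (he (by decide)) (he (by decide))
    (he (by decide)) h23).map ρ).three_le_finrank (apply_ne_one ρ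
      (by rwa [Nat.card_eq_fintype_card]) hne
      (doubleSwap_ne_one h01 (he (by decide)) (he (by decide)) h23))

theorem four_le_finrank [CharZero F] [FiniteDimensional F V] (hα : 8 ≤ Fintype.card α)
    (hne : ρ ≠ 1) : 4 ≤ Module.finrank F V := by
  obtain ⟨e⟩ := Function.Embedding.nonempty_of_card_le (α := Fin 8) (β := α) (by simp; lia)
  have he {x y : Fin 8} (h : x ≠ y) : e x ≠ e y := e.injective.ne h
  have hk {x y z w : Fin 8} (hxy : x ≠ y) (hxz : x ≠ z) (hxw : x ≠ w) (hyz : y ≠ z) (hyw : y ≠ w)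
      (hzw : z ≠ w) := (kleinTriple_doubleSwap (he hxy) (he hxz) (he hxw) (he hyz) (he hyw)
        (he hzw)).map ρ
  have hn {x y z w : Fin 8} (hxy : x ≠ y) (hxz : x ≠ z) (hxw : x ≠ w) (hzw : z ≠ w) :
      ρ (doubleSwap (he hxy) (he hzw)) ≠ 1 :=
    apply_ne_one ρ (by rw [Nat.card_eq_fintype_card]; lia) hne
      (doubleSwap_ne_one (he hxy) (he hxz) (he hxw) (he hzw))
  have hlg {x y : Fin 8} (hx : x < 4) (hy : 4 ≤ y) : e x ≠ e y := he (hx.trans_le hy).ne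
  have hcomm {x y z w x' y' z' w' : Fin 8} (hxy : x ≠ y) (hzw : z ≠ w) (hxy' : x' ≠ y')
      (hzw' : z' ≠ w') (hlt : x < 4 ∧ y < 4 ∧ z < 4 ∧ w < 4)
      (hge : 4 ≤ x' ∧ 4 ≤ y' ∧ 4 ≤ z' ∧ 4 ≤ w') :
      Commute (ρ (doubleSwap (he hxy') (he hzw'))) (ρ (doubleSwap (he hxy) (he hzw))) := by
    have hfix {p : Fin 8} (hp : p < 4) :
        (doubleSwap (he hxy') (he hzw') : Perm α) (e p) = e p := by
      rw [coe_doubleSwap, Perm.mul_apply,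
        swap_apply_of_ne_of_ne (hlg hp hge.2.2.1) (hlg hp hge.2.2.2),
        swap_apply_of_ne_of_ne (hlg hp hge.1) (hlg hp hge.2.1)]
    exact (commute_doubleSwap _ _ (hfix hlt.1) (hfix hlt.2.1) (hfix hlt.2.2.1)
      (hfix hlt.2.2.2)).map ρ
  exact (hk (x := 0) (y := 1) (z := 2) (w := 3) (by decide) (by decide) (by decide) (by decide)
    (by decide) (by decide)).four_le_finrank (hk (x := 4) (y := 5) (z := 6) (w := 7) (by decide)
    (by decide) (by decide) (by decide) (by decide) (by decide))
    (hn (by decide) (by decide) (by decide) (by decide))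
    (hn (by decide) (by decide) (by decide) (by decide))
    (hcomm (by decide) (by decide) (by decide) (by decide) (by decide) (by decide))
    (hcomm (by decide) (by decide) (by decide) (by decide) (by decide) (by decide))
    (hcomm (by decide) (by decide) (by decide) (by decide) (by decide) (by decide))
    (hcomm (by decide) (by decide) (by decide) (by decide) (by decide) (by decide))
    (hcomm (by decide) (by decide) (by decide) (by decide) (by decide) (by decide))
    (hcomm (by decide) (by decide) (by decide) (by decide) (by decide) (by decide))
    (hcomm (by decide) (by decide) (by decide) (by decide) (by decide) (by decide))

end Representation

/-- A nontrivial representation of the alternating group on an even number `n ≥ 10` of points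
has dimension at least `n - 1`. -/
theorem card_le_finrank_of_ne_one {F : Type*} [Field F] [CharZero F] (n : ℕ) (hn : Even n)
    (h10 : 10 ≤ n) (α : Type*) [Fintype α] [DecidableEq α] (hα : Fintype.card α = n)
    (V : Type*) [AddCommGroup V] [Module F V] [FiniteDimensional F V]
    (ρ : Representation F (alternatingGroup α) V) (hρ : ρ ≠ 1) :
    n ≤ Module.finrank F V + 1 := by
  induction n using Nat.strong_induction_on generalizing α V with
  | _ n ih =>
    by_cases hfix : FixesDifferences ρ
    · exact hα ▸ hfix.card_le (by lia) hρ
    · obtain ⟨a, b, c, d, hab, hac, had, hbc, hbd, hcd, hne⟩ : ∃ (a b c d : α) (hab : a ≠ b)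
          (_ : a ≠ c) (_ : a ≠ d) (_ : b ≠ c) (_ : b ≠ d) (hcd : c ≠ d),
          ¬ ∀ g : alternatingGroup α, (g : Perm α).support ⊆ {a, b, c, d}ᶜ → ∀ u,
            ρ g (u - ρ (doubleSwap hab hcd) u) = u - ρ (doubleSwap hab hcd) u := by
        by_contra! h
        exact hfix fun a b c d hab hac had hbc hbd hcd => h a b c d hab hac had hbc hbd hcd
      obtain ⟨K, τ, hτ, hK⟩ := (fixes_or_exists ρ hab hac had hbc hbd hcd).resolve_left hne
      have hcard : Fintype.card ({a, b, c, d}ᶜ : Finset α) = n - 4 := by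
        rw [Fintype.card_coe, Finset.card_compl, hα]
        congr 1
        simp [*]
      obtain ⟨m, rfl⟩ := hn
      have h3 := three_le_finrank τ (by lia) hτ
      by_cases hm5 : m = 5
      · lia
      have h4 := four_le_finrank τ (by lia) hτ
      by_cases hm6 : m = 6
      · lia
      have := ih (m + m - 4) (by lia) ⟨m - 2, by lia⟩ (by lia) _ hcard _ τ hτ
      lia

end alternatingGroup

/-- Let `n ≥ 10` be an even integer and `F` a field of characteristic `0`.
Every nontrivial finite-dimensional representation of the alternating group `A_n`
over `F` has dimension at least `n - 1`. -/
theorem stmt_0 (n : ℕ) (hn : Even n) (h10 : 10 ≤ n)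
    (F : Type) [Field F] [CharZero F]
    (V : Type) [AddCommGroup V] [Module F V] [FiniteDimensional F V]
    (ρ : alternatingGroup (Fin n) →* (V ≃ₗ[F] V)) (hρ : ρ ≠ 1) :
    n - 1 ≤ Module.finrank F V := by
  have := alternatingGroup.card_le_finrank_of_ne_one n hn h10 (Fin n) (Fintype.card_fin n) V
    ((LinearEquiv.automorphismGroup.toLinearMapMonoidHom (R := F) (M := V)).comp ρ) fun h => hρ <| by
      ext g v
      exact LinearMap.congr_fun (DFunLike.congr_fun h g) v
  lia
end

section
/- Let n ≥ 10 be an even integer and let F be a field of characteristic 2. Then every nontrivial finite-dimensional representation of the alternating group A_n over F has dimension at least n - 2. (In particular, writing n = 2g + 2, every nontrivial representation of A_n in characteristic 2 has dimension at least 2g.) -/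
open Equiv Module

section Embeddings

variable {α β γ : Type} [Fintype α] [DecidableEq α] [Fintype β] [DecidableEq β]
  [Fintype γ] [DecidableEq γ]

/-- The homomorphism of alternating groups induced by an embedding of finite sets. -/
def altEmb (f : α ↪ β) : alternatingGroup α →* alternatingGroup β where
  toFun x := ⟨(x : Perm α).viaFintypeEmbedding f, by
    rw [Perm.mem_alternatingGroup, Perm.viaFintypeEmbedding_sign]
    exact x.2⟩
  map_one' := Subtype.ext (Perm.extendDomain_one _)
  map_mul' x y := Subtype.ext (Perm.extendDomain_mul _ _ _).symm

theorem altEmb_apply (f : α ↪ β) (x : alternatingGroup α) (a : α) :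
    (altEmb f x : Perm β) (f a) = f ((x : Perm α) a) :=
  Perm.viaFintypeEmbedding_apply_image _ _ _

theorem altEmb_apply_of_forall_ne (f : α ↪ β) (x : alternatingGroup α) {b : β}
    (h : ∀ a, f a ≠ b) : (altEmb f x : Perm β) b = b :=
  Perm.viaFintypeEmbedding_apply_notMem_range _ _ (by simpa using h)

theorem altEmb_trans (f : α ↪ β) (g : β ↪ γ) (x : alternatingGroup α) :
    altEmb (f.trans g) x = altEmb g (altEmb f x) := by
  apply Subtype.ext
  ext c
  by_cases hc : ∃ b, g b = c
  · obtain ⟨b, rfl⟩ := hc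
    rw [altEmb_apply]
    by_cases hb : ∃ a, f a = b
    · obtain ⟨a, rfl⟩ := hb
      rw [altEmb_apply, ← Function.Embedding.trans_apply f g, altEmb_apply]
      rfl
    · push Not at hb
      rw [altEmb_apply_of_forall_ne f x hb, altEmb_apply_of_forall_ne]
      exact fun a h => hb a (g.injective h)
  · push Not at hc
    rw [altEmb_apply_of_forall_ne g _ hc, altEmb_apply_of_forall_ne _ _ fun a => hc (f a)]

theorem altEmb_commute (f : α ↪ γ) (g : β ↪ γ) (h : ∀ a b, f a ≠ g b)
    (x : alternatingGroup α) (y : alternatingGroup β) : altEmb f x * altEmb g y =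
      altEmb g y * altEmb f x := by
  apply Subtype.ext
  refine (Perm.Disjoint.commute fun c => ?_).eq
  by_cases hc : ∃ a, f a = c
  · obtain ⟨a, rfl⟩ := hc
    exact Or.inr (altEmb_apply_of_forall_ne g y fun b => (h a b).symm)
  · push Not at hc
    exact Or.inl (altEmb_apply_of_forall_ne f x hc)

/-- The standard three-cycle on three letters. -/
def stdCycle : alternatingGroup (Fin 3) := ⟨finRotate 3, Perm.mem_alternatingGroup.2 (by decide)⟩

/-- The three-cycle `(e 0 e 1 e 2)`. -/
def triCycle (e : Fin 3 ↪ α) : alternatingGroup α := altEmb e stdCycle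

theorem altEmb_triCycle (e : Fin 3 ↪ α) (f : α ↪ β) :
    altEmb f (triCycle e) = triCycle (e.trans f) :=
  (altEmb_trans e f stdCycle).symm

theorem triCycle_pow_three (e : Fin 3 ↪ α) : triCycle e ^ 3 = 1 := by
  rw [triCycle, ← map_pow, show stdCycle ^ 3 = 1 by decide, map_one]

theorem isThreeCycle_triCycle (e : Fin 3 ↪ α) : (triCycle e : Perm α).IsThreeCycle := by
  have h : (finRotate 3).IsThreeCycle := by
    rw [← card_support_eq_three_iff]; decide
  change ((finRotate 3).viaFintypeEmbedding e).IsThreeCycle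
  rw [Perm.viaFintypeEmbedding, Perm.IsThreeCycle, Perm.cycleType_extendDomain]
  exact h

end Embeddings

/-- The embedding of `Fin (k + m)` obtained by juxtaposing two embeddings with disjoint ranges. -/
def embAppend {α : Type} {k m : ℕ} (e : Fin k ↪ α) (f : Fin m ↪ α) (h : ∀ i j, e i ≠ f j) :
    Fin (k + m) ↪ α :=
  ⟨Fin.append e f, Fin.append_injective_iff.2 ⟨e.injective, f.injective, h⟩⟩

theorem castAddEmb_trans_embAppend {α : Type} {k m : ℕ} (e : Fin k ↪ α) (f : Fin m ↪ α)
    (h : ∀ i j, e i ≠ f j) : (Fin.castAddEmb m).trans (embAppend e f h) = e := by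
  ext i
  exact Fin.append_left _ _ _

theorem natAddEmb_trans_embAppend {α : Type} {k m : ℕ} (e : Fin k ↪ α) (f : Fin m ↪ α)
    (h : ∀ i j, e i ≠ f j) : (Fin.natAddEmb k).trans (embAppend e f h) = f := by
  ext i
  exact Fin.append_right _ _ _

/-- The embedding of `Fin 2` with prescribed values. -/
def embPair {α : Type} (a b : α) (h : a ≠ b) : Fin 2 ↪ α where
  toFun := ![a, b]
  inj' := by
    intro i j hij
    fin_cases i <;> fin_cases j <;> simp_all

/-- The embedding of `Fin 3` with prescribed values. -/
def embTriple {α : Type} (a b c : α) (hab : a ≠ b) (hac : a ≠ c) (hbc : b ≠ c) : Fin 3 ↪ α where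
  toFun := ![a, b, c]
  inj' := by
    intro i j hij
    fin_cases i <;> fin_cases j <;> simp_all

theorem triCycle_natAdd_eq_mul :
    triCycle (Fin.natAddEmb 2 : Fin 3 ↪ Fin 5) =
      triCycle (embTriple 0 1 2 (by decide) (by decide) (by decide)) *
      triCycle (embTriple 0 1 3 (by decide) (by decide) (by decide)) *
      triCycle (embTriple 0 1 4 (by decide) (by decide) (by decide)) *
      triCycle (embTriple 0 1 2 (by decide) (by decide) (by decide)) *
      triCycle (embTriple 0 1 3 (by decide) (by decide) (by decide)) := by
  decide

theorem exists_mul_triCycle_castAdd :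
    ∃ h : alternatingGroup (Fin 5), h * triCycle (Fin.castAddEmb 2 : Fin 3 ↪ Fin 5) =
      triCycle (Fin.castAddEmb 2 : Fin 3 ↪ Fin 5) ^ 2 * h :=
  ⟨⟨swap 0 1 * swap 3 4, Perm.mem_alternatingGroup.2 (by decide)⟩, by decide⟩

theorem exists_mul_triCycle_castAdd_natAdd :
    ∃ c d : alternatingGroup (Fin 6),
      c * triCycle (Fin.castAddEmb 3 : Fin 3 ↪ Fin 6) =
        triCycle (Fin.natAddEmb 3 : Fin 3 ↪ Fin 6) * c ∧
      c * triCycle (Fin.natAddEmb 3 : Fin 3 ↪ Fin 6) =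
        triCycle (Fin.castAddEmb 3 : Fin 3 ↪ Fin 6) ^ 2 * c ∧
      d * triCycle (Fin.natAddEmb 3 : Fin 3 ↪ Fin 6) =
        triCycle (Fin.castAddEmb 3 : Fin 3 ↪ Fin 6) * d ∧
      d * triCycle (Fin.castAddEmb 3 : Fin 3 ↪ Fin 6) =
        triCycle (Fin.natAddEmb 3 : Fin 3 ↪ Fin 6) ^ 2 * d :=
  ⟨⟨swap 0 3 * swap 1 4 * swap 2 5 * swap 4 5, Perm.mem_alternatingGroup.2 (by decide)⟩,
    ⟨swap 4 5 * swap 2 5 * swap 1 4 * swap 0 3, Perm.mem_alternatingGroup.2 (by decide)⟩,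
    by decide, by decide, by decide, by decide⟩

section Transport

variable {α : Type} [Fintype α] [DecidableEq α]

theorem exists_mul_triCycle_eq_sq_mul (e : Fin 3 ↪ α) {a b : α} (hab : a ≠ b)
    (ha : ∀ i, e i ≠ a) (hb : ∀ i, e i ≠ b) :
    ∃ h : alternatingGroup α, h * triCycle e = triCycle e ^ 2 * h := by
  obtain ⟨h, hh⟩ := exists_mul_triCycle_castAdd
  let f := embAppend e (embPair a b hab) (by
    intro i j
    fin_cases j
    exacts [ha i, hb i])
  refine ⟨altEmb f h, ?_⟩
  have he : triCycle e = altEmb f (triCycle (Fin.castAddEmb 2)) := by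
    rw [altEmb_triCycle, castAddEmb_trans_embAppend]
  rw [he, ← map_mul, hh, map_mul, map_pow]

theorem triCycle_mem_of_forall_triple_mem (H : Subgroup (alternatingGroup α)) (e : Fin 3 ↪ α)
    {a b : α} (hab : a ≠ b) (ha : ∀ i, a ≠ e i) (hb : ∀ i, b ≠ e i)
    (hH : ∀ i, triCycle (embTriple a b (e i) hab (ha i) (hb i)) ∈ H) : triCycle e ∈ H := by
  let f := embAppend (embPair a b hab) e (by
    intro i j
    fin_cases i
    exacts [ha j, hb j])
  have he : triCycle e = altEmb f (triCycle (Fin.natAddEmb 2)) := by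
    rw [altEmb_triCycle, natAddEmb_trans_embAppend]
  have h0 : ∀ (i : Fin 3) (j : Fin 5) (h1 : (0 : Fin 5) ≠ 1) (h2 : 0 ≠ j) (h3 : 1 ≠ j),
      f j = e i → altEmb f (triCycle (embTriple 0 1 j h1 h2 h3)) ∈ H := by
    intro i j h1 h2 h3 hj
    rw [altEmb_triCycle]
    convert hH i
    ext k
    fin_cases k
    exacts [rfl, rfl, hj]
  rw [he, triCycle_natAdd_eq_mul]
  simp only [map_mul]
  refine H.mul_mem (H.mul_mem (H.mul_mem (H.mul_mem ?_ ?_) ?_) ?_) ?_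
  exacts [h0 0 _ _ _ _ rfl, h0 1 _ _ _ _ rfl, h0 2 _ _ _ _ rfl, h0 0 _ _ _ _ rfl,
    h0 1 _ _ _ _ rfl]

theorem exists_mul_triCycle_pair (e e' : Fin 3 ↪ α) (hd : ∀ i j, e i ≠ e' j) :
    ∃ c d : alternatingGroup α,
      c * triCycle e = triCycle e' * c ∧ c * triCycle e' = triCycle e ^ 2 * c ∧
      d * triCycle e' = triCycle e * d ∧ d * triCycle e = triCycle e' ^ 2 * d := by
  obtain ⟨c, d, h1, h2, h3, h4⟩ := exists_mul_triCycle_castAdd_natAdd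
  have he : triCycle e = altEmb (embAppend e e' hd) (triCycle (Fin.castAddEmb 3)) := by
    rw [altEmb_triCycle, castAddEmb_trans_embAppend]
  have he' : triCycle e' = altEmb (embAppend e e' hd) (triCycle (Fin.natAddEmb 3)) := by
    rw [altEmb_triCycle, natAddEmb_trans_embAppend]
  refine ⟨altEmb (embAppend e e' hd) c, altEmb (embAppend e e' hd) d, ?_⟩
  rw [he, he']
  simp only [← map_mul, ← map_pow]
  exact ⟨congrArg _ h1, congrArg _ h2, congrArg _ h3, congrArg _ h4⟩

end Transport

section Linear

variable {F V : Type} [Field F] [AddCommGroup V] [Module F V]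

theorem eq_one_of_pow_three_of_sub_one_sq [CharP F 2] (T : End F V) (h3 : T ^ 3 = 1)
    (h : ∀ v, (T - 1) ((T - 1) v) = 0) : T = 1 := by
  ext v
  have h1 := h v
  have h2 : T (T (T v)) = v := LinearMap.congr_fun h3 v
  have h4 : (2 : F) • T v = 0 := by rw [CharTwo.two_eq_zero, zero_smul]
  have h5 : (2 : F) • v = 0 := by rw [CharTwo.two_eq_zero, zero_smul]
  rw [two_smul] at h4 h5
  simp only [LinearMap.sub_apply, End.one_apply, map_sub] at h1 ⊢
  have h6 : T (T v) = v := by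
    have : T (T v) = (T (T v) - T v - (T v - v)) + (T v + T v) - (v + v) + v := by abel
    rw [this, h1, h4, h5]; simp
  rw [h6] at h2
  exact h2

variable {α : Type} [Fintype α] [DecidableEq α]

theorem map_triCycle_ne_one {M : Type} [Monoid M] (h5 : 5 ≤ Nat.card α)
    (ρ : alternatingGroup α →* M) (hρ : ρ ≠ 1) (e : Fin 3 ↪ α) : ρ (triCycle e) ≠ 1 := by
  intro h
  have := alternatingGroup.isSimpleGroup h5
  rcases (inferInstance : ρ.ker.Normal).eq_bot_or_eq_top with hk | hk
  · have h1 : triCycle e = 1 := by rwa [← Subgroup.mem_bot, ← hk, MonoidHom.mem_ker]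
    apply (isThreeCycle_triCycle e).isCycle.ne_one
    rw [h1, Subgroup.coe_one]
  · refine hρ (MonoidHom.ext fun g => ?_)
    rw [MonoidHom.one_apply, ← MonoidHom.mem_ker, hk]
    exact Subgroup.mem_top g

theorem map_triCycle_pow_three {M : Type} [Monoid M] (ρ : alternatingGroup α →* M)
    (e : Fin 3 ↪ α) : ρ (triCycle e) ^ 3 = 1 := by
  rw [← map_pow, triCycle_pow_three, map_one]

theorem two_le_finrank_range_sub_one [CharP F 2] [FiniteDimensional F V] (S T : End F V)
    (hS : IsUnit S)
    (h3 : T ^ 3 = 1) (h1 : T ≠ 1) (hST : S * T = T ^ 2 * S) :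
    2 ≤ finrank F (LinearMap.range (T - 1)) := by
  by_contra! hlt
  obtain ⟨v, hv⟩ := finrank_le_one_iff.1 (Nat.le_of_lt_succ hlt)
  obtain ⟨v, u, rfl⟩ := v
  set v := (T - 1) u with hvdef
  have hv' : ∀ w, ∃ c : F, c • v = (T - 1) w := fun w => by
    obtain ⟨c, hc⟩ := hv ⟨_, w, rfl⟩
    exact ⟨c, congrArg Subtype.val hc⟩
  have hST' : ∀ w, S (T w) = T (T (S w)) := fun w => LinearMap.congr_fun hST w
  have hT3 : ∀ w, T (T (T w)) = w := fun w => LinearMap.congr_fun h3 w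
  have hSinj : ∀ w, S w = 0 → w = 0 := fun w hw => by
    obtain ⟨S', hS'⟩ := hS.exists_left_inv
    have := LinearMap.congr_fun hS' w
    simpa [hw] using this.symm
  apply h1
  apply eq_one_of_pow_three_of_sub_one_sq T h3
  intro w
  obtain ⟨c, hc⟩ := hv' w
  rw [← hc, map_smul]
  by_cases hv0 : v = 0
  · rw [hv0, map_zero, smul_zero]
  obtain ⟨l, hl⟩ := hv' v
  obtain ⟨m, hm⟩ := hv' (-(T (T (S u))))
  have hTv : T v = (l + 1) • v := by
    rw [add_smul, hl]; simp
  have hSv : S v = m • v := by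
    rw [hm, hvdef]
    simp [hST', hT3]
    abel
  have key := hST' v
  rw [hTv, map_smul, hSv, map_smul, map_smul, hTv, map_smul, hTv] at key
  have hm0 : m ≠ 0 := by
    rintro rfl
    rw [zero_smul] at hSv
    exact hv0 (hSinj v hSv)
  have hl1 : l + 1 ≠ 0 := by
    intro h0
    rw [h0, zero_smul] at hTv
    have := hT3 v
    rw [hTv, map_zero, map_zero] at this
    exact hv0 this.symm
  simp only [smul_smul] at key
  have key2 := smul_left_injective F hv0 key
  have hl0 : l = 0 := by
    have : (l + 1) * m * l = 0 := by linear_combination -key2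
    simpa [hm0, hl1] using this
  rw [hl0, zero_smul] at hl
  rw [← hl, smul_zero]

theorem exists_ne_forall_ne (S : Finset α) (hS : S.card + 2 ≤ Fintype.card α) :
    ∃ a b, a ≠ b ∧ a ∉ S ∧ b ∉ S := by
  have : 1 < Sᶜ.card := by rw [Finset.card_compl]; omega
  obtain ⟨a, ha, b, hb, hab⟩ := Finset.one_lt_card.1 this
  exact ⟨a, b, hab, by simpa using ha, by simpa using hb⟩

theorem two_le_finrank_range_triCycle [CharP F 2] [FiniteDimensional F V]
    (h5 : 5 ≤ Fintype.card α) (ρ : alternatingGroup α →* End F V) (hρ : ρ ≠ 1) (e : Fin 3 ↪ α) :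
    2 ≤ finrank F (LinearMap.range (ρ (triCycle e) - 1)) := by
  obtain ⟨a, b, hab, ha, hb⟩ := exists_ne_forall_ne (Finset.univ.map e) (by simpa using h5)
  obtain ⟨h, hh⟩ := exists_mul_triCycle_eq_sq_mul e hab (by simpa using ha) (by simpa using hb)
  refine two_le_finrank_range_sub_one (ρ h) _ ((Group.isUnit h).map ρ)
    (map_triCycle_pow_three ρ e) (map_triCycle_ne_one (by simpa using h5) ρ hρ e) ?_
  rw [← map_mul, hh, map_mul, map_pow]

/-- The subgroup of elements acting trivially on a submodule. -/
def fixator (ρ : alternatingGroup α →* End F V) (U : Submodule F V) :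
    Subgroup (alternatingGroup α) where
  carrier := {g | ∀ v ∈ U, ρ g v = v}
  one_mem' v _ := by simp
  mul_mem' {g h} hg hh v hv := by simp [hh v hv, hg v hv]
  inv_mem' {g} hg v hv := by
    have : ρ g⁻¹ (ρ g v) = v := by rw [← End.mul_apply, ← map_mul]; simp
    rwa [hg v hv] at this

/-- The sum of the images of `t - 1`, over the three-cycles `t` supported in `S`. -/
def movedBy (ρ : alternatingGroup α →* End F V) (S : Finset α) : Submodule F V :=
  ⨆ e : {e : Fin 3 ↪ α // ∀ i, e i ∈ S}, LinearMap.range (ρ (triCycle e.1) - 1)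

theorem range_le_movedBy (ρ : alternatingGroup α →* End F V) {S : Finset α} (e : Fin 3 ↪ α)
    (he : ∀ i, e i ∈ S) : LinearMap.range (ρ (triCycle e) - 1) ≤ movedBy ρ S :=
  le_iSup (fun e : {e : Fin 3 ↪ α // ∀ i, e i ∈ S} => LinearMap.range (ρ (triCycle e.1) - 1))
    ⟨e, he⟩

theorem movedBy_mono (ρ : alternatingGroup α →* End F V) {S T : Finset α} (h : S ⊆ T) :
    movedBy ρ S ≤ movedBy ρ T :=
  iSup_le fun e => range_le_movedBy ρ e.1 fun i => h (e.2 i)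

theorem movedBy_le_ker {ρ : alternatingGroup α →* End F V}
    (h : ∀ e e' : Fin 3 ↪ α, (∀ i j, e i ≠ e' j) →
      (ρ (triCycle e) - 1) * (ρ (triCycle e') - 1) = 0)
    {S : Finset α} (e : Fin 3 ↪ α) (he : ∀ i, e i ∉ S) :
    movedBy ρ S ≤ LinearMap.ker (ρ (triCycle e) - 1) := by
  refine iSup_le fun e' => ?_
  rintro _ ⟨v, rfl⟩
  exact LinearMap.congr_fun (h e e'.1 fun i j hij => he i (hij ▸ e'.2 j)) v

theorem exists_embThree {α : Type} (S : Finset α) (hS : 3 ≤ S.card) :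
    ∃ e : Fin 3 ↪ α, ∀ i, e i ∈ S := by
  obtain ⟨e⟩ := Function.Embedding.nonempty_of_card_le (α := Fin 3) (β := S) (by simpa using hS)
  exact ⟨e.trans (Function.Embedding.subtype _), fun i => (e i).2⟩

theorem card_sub_one_le_finrank_movedBy [CharP F 2] [FiniteDimensional F V]
    (h5 : 5 ≤ Fintype.card α) {ρ : alternatingGroup α →* End F V} (hρ : ρ ≠ 1)
    (h : ∀ e e' : Fin 3 ↪ α, (∀ i j, e i ≠ e' j) →
      (ρ (triCycle e) - 1) * (ρ (triCycle e') - 1) = 0)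
    (m : ℕ) (S : Finset α) (hS : S.card = m) (h3 : 3 ≤ m) (hm : m + 2 ≤ Fintype.card α) :
    m - 1 ≤ finrank F (movedBy ρ S) := by
  induction m, h3 using Nat.le_induction generalizing S with
  | base =>
    obtain ⟨e, he⟩ := exists_embThree S hS.ge
    exact (two_le_finrank_range_triCycle h5 ρ hρ e).trans
      (Submodule.finrank_mono (range_le_movedBy ρ e he))
  | succ m h3 ih =>
    obtain ⟨e, he⟩ := exists_embThree S (by omega)
    by_contra! hlt
    have heq : ∀ x ∈ S, movedBy ρ (S.erase x) = movedBy ρ S := by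
      intro x hx
      have hcard : (S.erase x).card = m := by rw [Finset.card_erase_of_mem hx, hS]; rfl
      have := ih (S.erase x) hcard (by omega)
      exact Submodule.eq_of_le_of_finrank_le (movedBy_mono ρ (Finset.erase_subset _ _)) (by omega)
    obtain ⟨a, b, hab, ha, hb⟩ := exists_ne_forall_ne S (by omega)
    have hae : ∀ i, a ≠ e i := fun i hi => ha (hi ▸ he i)
    have hbe : ∀ i, b ≠ e i := fun i hi => hb (hi ▸ he i)
    have hmem : triCycle e ∈ fixator ρ (movedBy ρ S) := by
      refine triCycle_mem_of_forall_triple_mem _ e hab hae hbe fun i v hv => ?_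
      rw [← heq _ (he i)] at hv
      have := movedBy_le_ker h (embTriple a b (e i) hab (hae i) (hbe i)) (fun j => by
        fin_cases j
        · exact fun hj => ha (Finset.mem_of_mem_erase hj)
        · exact fun hj => hb (Finset.mem_of_mem_erase hj)
        · exact Finset.notMem_erase _ _) hv
      simpa [sub_eq_zero] using this
    refine map_triCycle_ne_one (by simpa using h5) ρ hρ e
      (eq_one_of_pow_three_of_sub_one_sq _ (map_triCycle_pow_three ρ e) fun v => ?_)
    rw [LinearMap.sub_apply, hmem _ (range_le_movedBy ρ e he ⟨v, rfl⟩), End.one_apply, sub_self]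

theorem card_sub_two_le_finrank_of_mul_eq_zero [CharP F 2] [FiniteDimensional F V]
    (h6 : 6 ≤ Fintype.card α) {ρ : alternatingGroup α →* End F V} (hρ : ρ ≠ 1)
    (h : ∀ e e' : Fin 3 ↪ α, (∀ i j, e i ≠ e' j) →
      (ρ (triCycle e) - 1) * (ρ (triCycle e') - 1) = 0) :
    Fintype.card α - 2 ≤ finrank F V := by
  obtain ⟨e, -⟩ := exists_embThree (Finset.univ : Finset α) (by rw [Finset.card_univ]; omega)
  set S := (Finset.univ.map e)ᶜ with hS
  have hcard : S.card = Fintype.card α - 3 := by simp [hS, Finset.card_compl]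
  have h1 := card_sub_one_le_finrank_movedBy (by omega) hρ h _ S hcard (by omega) (by omega)
  have h2 := Submodule.finrank_mono (movedBy_le_ker h e (S := S) (by simp [hS]))
  have h3 := LinearMap.finrank_range_add_finrank_ker (ρ (triCycle e) - 1)
  have h4 := two_le_finrank_range_triCycle (by omega) ρ hρ e
  omega

theorem mem_eigenspace_sq_of_mul_eq {S T U : End F V} {l : F} {v : V} (hT : T ^ 3 = 1)
    (h : S * U = T ^ 2 * S) (hv : U v = l • v) : T (S v) = l ^ 2 • S v := by
  have h1 : ∀ w, S (U w) = T (T (S w)) := fun w => LinearMap.congr_fun h w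
  have h2 : ∀ w, T (T (T w)) = w := fun w => LinearMap.congr_fun hT w
  have h3 : T (T (S v)) = l • S v := by rw [← h1, hv, map_smul]
  rw [← h2 (T (S v)), h3, map_smul, map_smul, h3, smul_smul, sq]

theorem two_mul_finrank_eigenspace_le [FiniteDimensional F V] {S T : End F V}
    (hS : Function.Injective S) (hT : T ^ 3 = 1) (h : S * T = T ^ 2 * S) {l : F}
    (hl : l ^ 2 ≠ l) : 2 * finrank F (T.eigenspace l) ≤ finrank F V := by
  have h1 : (T.eigenspace l).map S ≤ T.eigenspace (l ^ 2) := by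
    rintro _ ⟨v, hv, rfl⟩
    exact End.mem_eigenspace_iff.2 (mem_eigenspace_sq_of_mul_eq hT h (End.mem_eigenspace_iff.1 hv))
  have h2 := (Submodule.equivMapOfInjective S hS (T.eigenspace l)).finrank_eq
  have h3 := Submodule.finrank_mono h1
  have h4 : Disjoint (T.eigenspace l) (T.eigenspace (l ^ 2)) := by
    rw [Submodule.disjoint_def]
    intro v hv hv'
    rw [End.mem_eigenspace_iff] at hv hv'
    rw [hv] at hv'
    by_contra hv0
    exact hl (smul_left_injective F hv0 hv').symm
  have h5 := Submodule.finrank_add_finrank_le_of_disjoint h4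
  omega

theorem exists_eigenvector_map_ne [CharP F 2] {T U : End F V} (hT : T ^ 3 = 1)
    (hTU : T * U = U * T) (h : (T - 1) * (U - 1) ≠ 0) {l : F} (hl : l ^ 2 + l + 1 = 0) :
    ∃ m : F, m ^ 2 + m + 1 = 0 ∧ ∃ v ∈ T.eigenspace m, U v ≠ v := by
  by_contra! hfix
  have hT3 : ∀ w, T (T (T w)) = w := fun w => LinearMap.congr_fun hT w
  have h2 : (2 : F) = 0 := CharTwo.two_eq_zero
  have key : ∀ v, ∀ m : F, m ^ 2 + m + 1 = 0 →
      U (T (T v - v) + (m + 1) • (T v - v)) = T (T v - v) + (m + 1) • (T v - v) := by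
    intro v m hm
    refine hfix m hm _ (End.mem_eigenspace_iff.2 ?_)
    simp only [map_add, map_sub, map_smul, hT3]
    have e2 : m * (m + 1) = 1 := by linear_combination hm - h2
    simp only [smul_add, smul_sub, smul_smul, e2]
    have e3 : (2 : F) • v = 0 := by rw [h2, zero_smul]
    have e4 : (2 : F) • T v = 0 := by rw [h2, zero_smul]
    linear_combination (norm := module) e3 - e4
  apply h
  have hcomm : (T - 1) * (U - 1) = (U - 1) * (T - 1) := by
    simp only [sub_mul, mul_sub, hTU, one_mul, mul_one]; abel
  rw [hcomm]
  ext v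
  have k1 := key v l hl
  have k2 := key v (l + 1) (by linear_combination hl + (l + 1) * h2)
  simp only [map_add, map_smul] at k1 k2
  change U (T v - v) - (T v - v) = 0
  linear_combination (norm := module) k2 - k1

theorem two_le_finrank_eigenspace [CharP F 2] [FiniteDimensional F V] {T U C D : End F V}
    (hT : T ^ 3 = 1) (hU : U ^ 3 = 1) (hTU : T * U = U * T)
    (hC : Function.Injective C) (hD : Function.Injective D)
    (hC1 : C * T = U * C) (hC2 : C * U = T ^ 2 * C)
    (hD1 : D * U = T * D) (hD2 : D * T = U ^ 2 * D) {l : F} (hl : l ^ 2 + l + 1 = 0)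
    (h : ∃ v ∈ T.eigenspace l, U v ≠ v) : 2 ≤ finrank F (T.eigenspace l) := by
  by_contra! hlt
  obtain ⟨⟨v, hv⟩, hspan⟩ := finrank_le_one_iff.1 (Nat.le_of_lt_succ hlt)
  replace hspan : ∀ w, T w = l • w → ∃ c : F, c • v = w := fun w hw => by
    obtain ⟨c, hc⟩ := hspan ⟨w, End.mem_eigenspace_iff.2 hw⟩
    exact ⟨c, congrArg Subtype.val hc⟩
  have h2 : (2 : F) = 0 := CharTwo.two_eq_zero
  rw [End.mem_eigenspace_iff] at hv
  have hTU' : ∀ w, T (U w) = U (T w) := fun w => LinearMap.congr_fun hTU w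
  have hU3 : ∀ w, U (U (U w)) = w := fun w => LinearMap.congr_fun hU w
  have hl1 : l ≠ l + 1 := by simp
  have hlsq : l ^ 2 = l + 1 := by linear_combination hl - (l + 1) * h2
  obtain ⟨b, hb⟩ := hspan (U v) (by rw [hTU', hv, map_smul])
  have hUv : U v ≠ v := by
    obtain ⟨w, hw, hUw⟩ := h
    obtain ⟨c, rfl⟩ := hspan w (End.mem_eigenspace_iff.1 hw)
    exact fun hUv => hUw (by rw [map_smul, hUv])
  have hv0 : v ≠ 0 := by
    rintro rfl
    exact hUv (map_zero U)
  have hb1 : b ≠ 1 := by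
    rintro rfl
    exact hUv (by rw [← hb, one_smul])
  have hb3 : b * (b * b) = 1 := by
    have := hU3 v
    rw [← hb, map_smul, map_smul, ← hb, map_smul, ← hb, smul_smul, smul_smul] at this
    exact smul_left_injective F hv0 (by simpa [mul_assoc] using this)
  have hbl : b = l ∨ b = l + 1 := by
    have h0 : (b - 1) * ((b - l) * (b - (l + 1))) = 0 := by
      linear_combination hb3 + (b - 1) * hl - l * b * (b - 1) * h2 - b * (b - 1) * h2 + (1 - b) * h2
    rcases mul_eq_zero.1 h0 with h0 | h0
    · exact absurd (sub_eq_zero.1 h0) hb1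
    · simpa [sub_eq_zero] using h0
  have huniq : ∀ S : End F V, Function.Injective S → ∀ c : F, T (S v) = l • S v →
      U (S v) = c • S v → c = b := by
    intro S hS c h1 h2
    obtain ⟨d, hd⟩ := hspan _ h1
    have hne : S v ≠ 0 := fun h0 => hv0 (hS (h0.trans (map_zero S).symm))
    have h4 : b • S v = c • S v := by
      rw [← h2, ← hd, map_smul, ← hb, smul_comm]
    exact (smul_left_injective F hne h4).symm
  rcases hbl with rfl | rfl
  · have h1 : T (D v) = b • D v := by
      rw [← LinearMap.map_smul, hb]
      exact (LinearMap.congr_fun hD1 v).symm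
    have h3 := mem_eigenspace_sq_of_mul_eq hU hD2 hv
    exact hl1 ((huniq D hD _ h1 h3).symm.trans hlsq)
  · have h1 := mem_eigenspace_sq_of_mul_eq hT hC2 hb.symm
    rw [show (l + 1) ^ 2 = l by linear_combination hl] at h1
    have h3 : U (C v) = l • C v := by
      rw [← LinearMap.map_smul, ← hv]
      exact (LinearMap.congr_fun hC1 v).symm
    exact hl1 (huniq C hC _ h1 h3)

theorem map_injective {G : Type} [Group G] (ρ : G →* End F V) (g : G) :
    Function.Injective (ρ g) := by
  intro v w h
  have h1 : ∀ u, ρ g⁻¹ (ρ g u) = u := fun u => by rw [← End.mul_apply, ← map_mul]; simp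
  rw [← h1 v, h, h1]

/-- The representation on an invariant submodule. -/
def restrictRep {G : Type} [Group G] (ρ : G →* End F V) (W : Submodule F V)
    (h : ∀ g, ∀ w ∈ W, ρ g w ∈ W) : G →* End F W where
  toFun g := (ρ g).restrict (h g)
  map_one' := by ext; simp
  map_mul' g g' := by ext; simp

theorem exists_submodule_rep [CharP F 2] [FiniteDimensional F V] {n : ℕ}
    (ρ : alternatingGroup (Fin n) →* End F V) {l : F} (hl : l ^ 2 + l + 1 = 0) (hn : 5 ≤ n)
    (e e' : Fin 3 ↪ Fin n) (hd : ∀ i j, e i ≠ e' j)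
    (hne : (ρ (triCycle e) - 1) * (ρ (triCycle e') - 1) ≠ 0) :
    ∃ W : Submodule F V, 2 ≤ finrank F W ∧ 2 * finrank F W ≤ finrank F V ∧
      ∃ ρ' : alternatingGroup (Fin (n - 3)) →* End F W, ρ' ≠ 1 := by
  obtain ⟨c, d, h1, h2, h3, h4⟩ := exists_mul_triCycle_pair e e' hd
  obtain ⟨a, b, hab, ha, hb⟩ := exists_ne_forall_ne (Finset.univ.map e) (by simpa using hn)
  obtain ⟨s, hs⟩ := exists_mul_triCycle_eq_sq_mul e hab (by simpa using ha) (by simpa using hb)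
  have hcomm : ρ (triCycle e) * ρ (triCycle e') = ρ (triCycle e') * ρ (triCycle e) := by
    rw [← map_mul, ← map_mul, triCycle, triCycle, altEmb_commute _ _ hd]
  obtain ⟨m, hm, hex⟩ := exists_eigenvector_map_ne (map_triCycle_pow_three ρ e) hcomm hne hl
  refine ⟨(ρ (triCycle e)).eigenspace m, ?_, ?_, ?_⟩
  · refine two_le_finrank_eigenspace (map_triCycle_pow_three ρ e) (map_triCycle_pow_three ρ e')
      hcomm (map_injective ρ c) (map_injective ρ d) ?_ ?_ ?_ ?_ hm hex <;>
    simp only [← map_mul, ← map_pow] <;> apply congrArg <;> assumption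
  · refine two_mul_finrank_eigenspace_le (map_injective ρ s) (map_triCycle_pow_three ρ e) ?_ ?_
    · rw [← map_mul, hs, map_mul, map_pow]
    · intro h
      have : (1 : F) = 0 := by linear_combination hm - h - m * CharTwo.two_eq_zero (R := F)
      exact one_ne_zero this
  · have hcard : (Finset.univ.map e)ᶜ.card = n - 3 := by simp [Finset.card_compl]
    let g : Fin (n - 3) ↪ Fin n := ((Finset.univ.map e)ᶜ.orderEmbOfFin hcard).toEmbedding
    have hg : ∀ x, (∀ i, e i ≠ x) → ∃ y, g y = x := fun x hx => by
      have : x ∈ Set.range ((Finset.univ.map e)ᶜ.orderEmbOfFin hcard) := by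
        rw [Finset.range_orderEmbOfFin]; simpa using hx
      exact this
    have hg' : ∀ i y, e i ≠ g y := fun i y => by
      have : g y ∈ (Finset.univ.map e)ᶜ := Finset.orderEmbOfFin_mem _ hcard y
      simp only [Finset.mem_compl, Finset.mem_map, Finset.mem_univ, true_and, not_exists] at this
      exact this i
    choose f hf using fun j => hg (e' j) fun i => hd i j
    let e'' : Fin 3 ↪ Fin (n - 3) := ⟨f, fun i j hij => e'.injective (by rw [← hf, hij, hf])⟩
    have he'' : e''.trans g = e' := Function.Embedding.ext hf
    refine ⟨restrictRep (ρ.comp (altEmb g)) _ fun x w hw => ?_, fun h => ?_⟩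
    · rw [End.mem_eigenspace_iff] at hw ⊢
      have hx : ρ (triCycle e) * ρ (altEmb g x) = ρ (altEmb g x) * ρ (triCycle e) := by
        rw [← map_mul, ← map_mul, triCycle, altEmb_commute _ _ hg']
      rw [MonoidHom.comp_apply, ← End.mul_apply, hx, End.mul_apply, hw, map_smul]
    · obtain ⟨v, hv, hne'⟩ := hex
      have := congrArg Subtype.val
        (LinearMap.congr_fun (DFunLike.congr_fun h (triCycle e'')) ⟨v, hv⟩)
      apply hne'
      rw [← he'', ← altEmb_triCycle]
      exact this

theorem finrank_or_exists_submodule_rep [CharP F 2] [FiniteDimensional F V] {n : ℕ} (hn : 6 ≤ n)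
    (ρ : alternatingGroup (Fin n) →* End F V) (hρ : ρ ≠ 1) {l : F} (hl : l ^ 2 + l + 1 = 0) :
    n - 2 ≤ finrank F V ∨ ∃ W : Submodule F V, 2 ≤ finrank F W ∧
      2 * finrank F W ≤ finrank F V ∧
      ∃ ρ' : alternatingGroup (Fin (n - 3)) →* End F W, ρ' ≠ 1 := by
  by_cases h : ∀ e e' : Fin 3 ↪ Fin n, (∀ i j, e i ≠ e' j) →
      (ρ (triCycle e) - 1) * (ρ (triCycle e') - 1) = 0
  · left
    simpa using card_sub_two_le_finrank_of_mul_eq_zero (by simpa using hn) hρ h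
  · right
    push Not at h
    obtain ⟨e, e', hd, hne⟩ := h
    exact exists_submodule_rep ρ hl (by omega) e e' hd hne

end Linear

theorem four_le_finrank {F : Type} [Field F] [CharP F 2] {l : F} (hl : l ^ 2 + l + 1 = 0)
    {n : ℕ} (hn : 6 ≤ n) {V : Type} [AddCommGroup V] [Module F V] [FiniteDimensional F V]
    (ρ : alternatingGroup (Fin n) →* End F V) (hρ : ρ ≠ 1) : 4 ≤ finrank F V := by
  rcases finrank_or_exists_submodule_rep hn ρ hρ hl with h | ⟨W, h1, h2, -⟩ <;> omega

theorem sub_three_le_finrank {F : Type} [Field F] [CharP F 2] {l : F} (hl : l ^ 2 + l + 1 = 0)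
    {n : ℕ} (hn : 9 ≤ n) {V : Type} [AddCommGroup V] [Module F V] [FiniteDimensional F V]
    (ρ : alternatingGroup (Fin n) →* End F V) (hρ : ρ ≠ 1) : n - 3 ≤ finrank F V := by
  induction n using Nat.strong_induction_on generalizing V with
  | _ n ih =>
    rcases finrank_or_exists_submodule_rep (by omega) ρ hρ hl with h | ⟨W, -, h2, ρ', hρ'⟩
    · omega
    · have h4 := four_le_finrank hl (by omega) ρ' hρ'
      by_cases h12 : 12 ≤ n
      · have := ih (n - 3) (by omega) (by omega) ρ' hρ'
        omega
      · omega

theorem sub_two_le_finrank {F : Type} [Field F] [CharP F 2] {l : F} (hl : l ^ 2 + l + 1 = 0)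
    {n : ℕ} (hn : Even n) (h10 : 10 ≤ n) {V : Type} [AddCommGroup V] [Module F V]
    [FiniteDimensional F V] (ρ : alternatingGroup (Fin n) →* End F V) (hρ : ρ ≠ 1) :
    n - 2 ≤ finrank F V := by
  rcases finrank_or_exists_submodule_rep (by omega) ρ hρ hl with h | ⟨W, -, h2, ρ', hρ'⟩
  · exact h
  · have h4 := four_le_finrank hl (by omega) ρ' hρ'
    by_cases h12 : 12 ≤ n
    · have := sub_three_le_finrank hl (by omega) ρ' hρ'
      omega
    · obtain ⟨k, rfl⟩ := hn
      omega

/-- Let `n ≥ 10` be an even integer and `F` a field of characteristic `2`.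
Every nontrivial finite-dimensional representation of the alternating group `A_n`
over `F` has dimension at least `n - 2`. -/
theorem stmt_1 (n : ℕ) (hn : Even n) (h10 : 10 ≤ n)
    (F : Type) [Field F] [CharP F 2]
    (V : Type) [AddCommGroup V] [Module F V] [FiniteDimensional F V]
    (ρ : alternatingGroup (Fin n) →* (V ≃ₗ[F] V)) (hρ : ρ ≠ 1) :
    n - 2 ≤ Module.finrank F V := by
  let K := AlgebraicClosure F
  have : CharP K 2 := charP_of_injective_algebraMap (algebraMap F K).injective 2
  obtain ⟨l, hl⟩ : ∃ l : K, l ^ 2 + l + 1 = 0 := by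
    obtain ⟨l, hl⟩ := IsAlgClosed.exists_root
      (Polynomial.X ^ 2 + Polynomial.X + 1 : Polynomial K) (by
        rw [show (Polynomial.X ^ 2 + Polynomial.X + 1 : Polynomial K).degree = 2 by compute_degree!]
        decide)
    exact ⟨l, by simpa using hl⟩
  let ρK : alternatingGroup (Fin n) →* End K (TensorProduct F K V) :=
    ((End.baseChangeHom F K V : End F V →* End K (TensorProduct F K V)).comp
      (LinearEquiv.automorphismGroup.toLinearMapMonoidHom)).comp ρ
  have hρK : ρK ≠ 1 := by
    intro h
    apply hρ
    ext g v
    have h1 : (ρ g : V →ₗ[F] V).baseChange K = (1 : End F V).baseChange K := by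
      rw [LinearMap.baseChange_one]
      exact DFunLike.congr_fun h g
    exact LinearMap.congr_fun (LinearMap.baseChangeHom_injective F V K h1) v
  have := sub_two_le_finrank hl hn h10 ρK hρK
  rwa [Module.finrank_baseChange] at this
end

section
/- Let n ≥ 10 be an even integer, let G' be a finite group, and let π : G' → A_n be a surjective group homomorphism whose kernel is a central subgroup of G' of order 2. Let F be a field of characteristic 0. Then every faithful irreducible finite-dimensional representation of G' over F has dimension different from n - 2. (Equivalently, writing n = 2g + 2: every nontrivial proper projective representation of A_n in characteristic 0 has dimension ≠ 2g.) -/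
section

open Equiv Equiv.Perm Module

/-- A map from permutations to a ring which is multiplicative up to sign on even permutations. -/
structure IsSignedHom {α R : Type*} [DecidableEq α] [Fintype α] [Ring R]
    (T : Perm α → R) : Prop where
  one : T 1 = 1 ∨ T 1 = -1
  mul : ∀ σ τ, sign σ = 1 → sign τ = 1 → T (σ * τ) = T σ * T τ ∨ T (σ * τ) = -(T σ * T τ)

/-- The sixteenth power of the value at `σ`: a lift of `σ`, free of the sign ambiguity, when
`σ ^ 16 = σ`. -/
def oddLift {α R : Type*} [Ring R] (T : Perm α → R) (σ : Perm α) : R := T σ ^ 16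

namespace IsSignedHom

variable {α R : Type*} [DecidableEq α] [Fintype α] [Ring R] {T : Perm α → R}

theorem pow (hT : IsSignedHom T) {σ : Perm α} (hσ : sign σ = 1) (k : ℕ) :
    T (σ ^ k) = T σ ^ k ∨ T (σ ^ k) = -(T σ ^ k) := by
  induction k with
  | zero => simpa using hT.one
  | succ k ih =>
    rw [pow_succ, pow_succ]
    rcases hT.mul (σ ^ k) σ (by simp [hσ]) hσ with h | h <;> rcases ih with h' | h' <;>
      simp [h, h']

theorem pow_sixteen_eq {x y : R} (h : x = y ∨ x = -y) : x ^ 16 = y ^ 16 := by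
  rcases h with rfl | rfl
  · rfl
  · exact Even.neg_pow (by decide) y

theorem oddLift_pow (hT : IsSignedHom T) {σ : Perm α} (hσ : sign σ = 1) (k : ℕ) :
    oddLift T (σ ^ k) = oddLift T σ ^ k := by
  rw [oddLift, pow_sixteen_eq (hT.pow hσ k), oddLift, ← pow_mul, ← pow_mul, mul_comm]

theorem oddLift_one (hT : IsSignedHom T) : oddLift T 1 = 1 := by
  rw [oddLift, pow_sixteen_eq hT.one, one_pow]

theorem oddLift_pow_eq_one (hT : IsSignedHom T) {σ : Perm α} (hσ : sign σ = 1) {k : ℕ}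
    (h : σ ^ k = 1) : oddLift T σ ^ k = 1 := by
  rw [← hT.oddLift_pow hσ, h, hT.oddLift_one]

theorem eq_oddLift (hT : IsSignedHom T) {σ : Perm α} (hσ : sign σ = 1) (h : σ ^ 16 = σ) :
    T σ = oddLift T σ ∨ T σ = -oddLift T σ := by
  have := hT.pow hσ 16
  rwa [h] at this

theorem oddLift_mul (hT : IsSignedHom T) {σ τ : Perm α} (hσ : sign σ = 1) (h : σ ^ 16 = σ)
    (hτ : sign τ = 1) (h' : τ ^ 16 = τ) :
    oddLift T (σ * τ) = (oddLift T σ * oddLift T τ) ^ 16 := by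
  apply pow_sixteen_eq
  rcases hT.mul σ τ hσ hτ with h₁ | h₁ <;> rcases hT.eq_oddLift hσ h with h₂ | h₂ <;>
    rcases hT.eq_oddLift hτ h' with h₃ | h₃ <;> simp [h₁, h₂, h₃]

theorem conj (hT : IsSignedHom T) {σ τ : Perm α} (hσ : sign σ = 1) (hτ : sign τ = 1) :
    T τ * oddLift T σ = oddLift T (τ * σ * τ⁻¹) * T τ := by
  have h₁ := hT.mul τ σ hτ hσ
  have h₂ := hT.mul (τ * σ * τ⁻¹) τ (by simp [hσ, hτ]) hτ
  rw [inv_mul_cancel_right] at h₂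
  have h : SemiconjBy (T τ) (T σ) (T (τ * σ * τ⁻¹)) ∨
      SemiconjBy (T τ) (T σ) (-T (τ * σ * τ⁻¹)) := by
    simp only [SemiconjBy, neg_mul]
    rcases h₁ with h₁ | h₁ <;> rcases h₂ with h₂ | h₂ <;> rw [h₁] at h₂ <;>
      simp_all [neg_eq_iff_eq_neg]
  rcases h with h | h
  · exact h.pow_right 16
  · have := h.pow_right 16
    rwa [Even.neg_pow (by decide)] at this

theorem oddLift_conj (hT : IsSignedHom T) {σ τ : Perm α} (hσ : sign σ = 1) (hτ : sign τ = 1)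
    (h : τ ^ 16 = τ) :
    oddLift T τ * oddLift T σ = oddLift T (τ * σ * τ⁻¹) * oddLift T τ := by
  have := hT.conj hσ hτ
  rcases hT.eq_oddLift hτ h with h' | h' <;> rw [h'] at this <;> simpa using this

theorem isUnit (hT : IsSignedHom T) {σ : Perm α} (hσ : sign σ = 1) :
    T σ⁻¹ * T σ = 1 ∨ T σ⁻¹ * T σ = -1 := by
  have h₁ := hT.mul σ⁻¹ σ (by simp [hσ]) hσ
  rw [inv_mul_cancel] at h₁
  rcases h₁ with h₁ | h₁ <;> rcases hT.one with h₂ | h₂ <;> rw [h₁] at h₂ <;>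
    simp_all [neg_eq_iff_eq_neg]

theorem apply_eq_zero {K V : Type*} [Field K] [AddCommGroup V] [Module K V]
    {T : Perm α → End K V} (hT : IsSignedHom T) {σ : Perm α} (hσ : sign σ = 1) {v : V}
    (h : T σ v = 0) : v = 0 := by
  have h' : (T σ⁻¹ * T σ) v = 0 := by simp [h]
  rcases hT.isUnit hσ with h₁ | h₁ <;> rw [h₁] at h' <;> simpa using h'

end IsSignedHom

theorem sum_finrank_le_of_iSupIndep {ι K V : Type*} [Fintype ι] [DecidableEq ι] [Field K]
    [AddCommGroup V] [Module K V] [FiniteDimensional K V] {p : ι → Submodule K V}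
    (hp : iSupIndep p) : ∑ i, finrank K (p i) ≤ finrank K V := by
  have hinj := hp.dfinsupp_lsum_injective
  let e : (Π i, p i) ≃ₗ[K] (Π₀ i, p i) := (DFinsupp.linearEquivFunOnFintype).symm
  have := LinearMap.finrank_le_finrank_of_injective (f := (DFinsupp.lsum ℕ fun i => (p i).subtype) ∘ₗ e.toLinearMap)
    (hinj.comp e.injective)
  rwa [Module.finrank_pi_fintype] at this

section
variable {K V : Type*} [Field K] [AddCommGroup V] [Module K V] [FiniteDimensional K V]

theorem four_mul_le_finrank {p : End K V} {l : K} (hl : l ^ 5 = 1) (hl1 : l ≠ 1) {d : ℕ}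
    (h : ∀ i : ℕ, ¬ 5 ∣ i → d ≤ finrank K (p.eigenspace (l ^ i))) : 4 * d ≤ finrank K V := by
  have hprim : IsPrimitiveRoot l 5 := by
    have : Fact (Nat.Prime 5) := ⟨by norm_num⟩
    exact IsPrimitiveRoot.iff_orderOf.2 (orderOf_eq_prime hl hl1)
  have hinj : Function.Injective (fun i : Fin 4 => l ^ ((i : ℕ) + 1)) := by
    intro i j hij
    have := hprim.pow_inj (by omega) (by omega) hij
    exact Fin.ext (by omega)
  have hind := p.eigenspaces_iSupIndep.comp hinj
  have h4 := sum_finrank_le_of_iSupIndep hind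
  refine le_trans ?_ h4
  calc 4 * d = ∑ _i : Fin 4, d := by simp
    _ ≤ _ := Finset.sum_le_sum fun i _ => h _ (by omega)

theorem exists_eigenvector_apply_ne_zero [CharZero K] [IsAlgClosed K] {p X : End K V} (hp : p ^ 5 = 1) (hX : X ≠ 0) :
    ∃ l : K, l ^ 5 = 1 ∧ ∃ v, p v = l • v ∧ X v ≠ 0 := by
  have hss : p.IsSemisimple := by
    refine End.isSemisimple_of_squarefree_aeval_eq_zero
      (p := (Polynomial.X ^ 5 - 1 : Polynomial K)) ?_ (by simp [hp])
    exact (Polynomial.separable_X_pow_sub_C (1 : K) (n := 5) (by norm_num) one_ne_zero).squarefree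
  have htop : ⨆ l, p.eigenspace l = ⊤ := by
    rw [← End.iSup_maxGenEigenspace_eq_top p]
    congr 1
    ext1 l
    exact (hss.isFinitelySemisimple.maxGenEigenspace_eq_eigenspace l).symm
  by_contra! hcon
  apply hX
  rw [← LinearMap.ker_eq_top, eq_top_iff, ← htop, iSup_le_iff]
  intro l v hv
  rw [End.mem_eigenspace_iff] at hv
  rw [LinearMap.mem_ker]
  by_cases hv0 : v = 0
  · simp [hv0]
  refine hcon l ?_ v hv
  have h1 : (p ^ 5) v = l ^ 5 • v := by
    have : ∀ k : ℕ, (p ^ k) v = l ^ k • v := fun k => by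
      induction k with
      | zero => simp
      | succ k ih => rw [pow_succ', Module.End.mul_apply, ih, map_smul, hv, smul_smul, pow_succ]
    exact this 5
  rw [hp, Module.End.one_apply] at h1
  have h2 : (l ^ 5 - 1) • v = 0 := by rw [sub_smul, ← h1, one_smul, sub_self]
  exact sub_eq_zero.1 ((smul_eq_zero.1 h2).resolve_right hv0)
end

theorem exists_tetrahedral_vector {K V : Type*} [Field K] [CharZero K] [AddCommGroup V]
    [Module K V] {a b : End K V} (ha : a ^ 3 = 1) (hb : b ^ 3 = 1) (hab : (a * b) ^ 2 = 1)
    (hne : a * b ≠ 1) :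
    ∃ v : V, (∃ w, v = a w - w) ∧ (∃ w, v = b w - w) ∧ a v + a (b v) = b v ∧ a v ≠ b v ∧
      ∀ x y : K, x • v + y • (v + a v) = 0 → x = 0 ∧ y = 0 := by
  obtain ⟨k, hk⟩ : ∃ k, k = a * b := ⟨_, rfl⟩
  rw [← hk] at hab hne
  have ha' : ∀ x, a * (a * (a * x)) = x := fun x => by
    rw [← mul_assoc, ← mul_assoc, ← pow_three', ha, one_mul]
  have hbk : b = a * (a * k) := by rw [hk, ha']
  have hkk : ∀ x, k * (k * x) = x := fun x => by rw [← mul_assoc, ← sq, hab, one_mul]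
  have h3 : k * a * k * a * k * a = 1 := by
    have hb1 : a * a * k * (a * a * k) * (a * a * k) = 1 := by
      rw [hbk, pow_three'] at hb; simpa only [mul_assoc] using hb
    have e1 : (k * a * k * a * k * a) * (a * a * k * (a * a * k) * (a * a * k)) = 1 := by
      simp only [mul_assoc, ha', hkk]
      rw [← sq, hab]
    rwa [hb1, mul_one] at e1
  obtain ⟨k₁, hk₁⟩ : ∃ k₁, k₁ = a * k * a * a := ⟨_, rfl⟩
  obtain ⟨k₃, hk₃⟩ : ∃ k₃, k₃ = a * a * k * a := ⟨_, rfl⟩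
  have ha3 : a * (a * a) = 1 := by rw [← pow_three, ha]
  have hkk' : k * k = 1 := by rw [← sq, hab]
  have hk31 : k₃ * k = k₁ := by
    have : k * a * k * a * k * a * (a * a) = a * a := by rw [h3, one_mul]
    simp only [mul_assoc, ha3, mul_one] at this
    have h4 : k * (k * (a * (k * (a * k)))) = k * (a * a) := by rw [this]
    rw [hkk] at h4
    simp only [hk₃, hk₁, mul_assoc, h4]
  have hk3 : k₃ = k₁ * k := by rw [← hk31, mul_assoc, hkk', mul_one]
  have hk11 : k₁ * k₁ = 1 := by simp only [hk₁, mul_assoc, ha', hkk, ha3]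
  have hk33 : k₃ * k₃ = 1 := by simp only [hk₃, mul_assoc, ha', hkk, ha3]
  have hcomm : k * k₁ = k₁ * k := by
    have : (k₁ * k) * (k₁ * k) = 1 := by rw [← hk3, hk33]
    calc k * k₁ = (k₁ * k₁) * (k * k₁) * (k * k) := by rw [hk11, hkk', one_mul, mul_one]
      _ = k₁ * ((k₁ * k) * (k₁ * k)) * k := by simp only [mul_assoc]
      _ = k₁ * k := by rw [this, mul_one]
  have hX : (1 + k₁) * (1 - k) ≠ 0 := by
    intro h
    have e1 : 1 + k₁ = k + k₃ := by
      rw [hk3]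
      have : (1 + k₁) * (1 - k) = (1 + k₁) - (k + k₁ * k) := by noncomm_ring
      rw [h] at this
      exact sub_eq_zero.1 this.symm
    have e2 : 1 + k₃ = k₁ + k := by
      have := congrArg (fun x => a * (x * (a * a))) e1
      simp only [mul_add, add_mul, one_mul] at this
      rw [ha3] at this
      have q1 : a * (k₁ * (a * a)) = k₃ := by simp only [hk₁, hk₃, mul_assoc, ha']
      have q2 : a * (k₃ * (a * a)) = k := by simp only [hk₃, mul_assoc, ha', ha3, mul_one]
      have q3 : a * (k * (a * a)) = k₁ := by simp only [hk₁, mul_assoc]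
      rwa [q1, q2, q3] at this
    have e3 : (2 : K) • (k₁ - k₃) = 0 := by
      have : (1 + k₁) - (1 + k₃) = (k + k₃) - (k₁ + k) := by rw [e1, e2]
      rw [two_smul]
      calc k₁ - k₃ + (k₁ - k₃) = ((1 + k₁) - (1 + k₃)) - ((k + k₃) - (k₁ + k)) := by abel
        _ = 0 := by rw [this, sub_self]
    have e4 : k₁ = k₃ := sub_eq_zero.1 ((smul_eq_zero.1 e3).resolve_left two_ne_zero)
    apply hne
    calc k = k₁ * (k₁ * k) := by rw [← mul_assoc, hk11, one_mul]
      _ = 1 := by rw [← hk3, ← e4, hk11]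
  obtain ⟨w, hw⟩ : ∃ w, ((1 + k₁) * (1 - k)) w ≠ 0 := by
    by_contra! h
    exact hX (LinearMap.ext h)
  obtain ⟨y, hy⟩ : ∃ y, y = ((1 + k₁) * (1 - k)) w := ⟨_, rfl⟩
  rw [← hy] at hw
  have hk1y : k₁ y = y := by
    rw [hy, ← End.mul_apply]
    congr 1
    calc k₁ * ((1 + k₁) * (1 - k)) = (k₁ + k₁ * k₁) * (1 - k) := by noncomm_ring
      _ = _ := by rw [hk11]; congr 1; abel
  have hky : k y = -y := by
    rw [hy, ← End.mul_apply, ← LinearMap.neg_apply]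
    congr 1
    calc k * ((1 + k₁) * (1 - k)) = k - k * k + k * k₁ - k * k₁ * k := by noncomm_ring
      _ = -((1 + k₁) * (1 - k)) := by
        rw [hcomm, hkk', mul_assoc, hkk']; noncomm_ring
  have A : a (a (a y)) = y := by
    simpa only [End.mul_apply, End.one_apply] using LinearMap.congr_fun ha3 y
  have B : ∀ x, b x = a (a (k x)) := fun x => by rw [hbk]; rfl
  have k2 : k (a y) = -(a y) := by
    have h := LinearMap.congr_fun (show k * a = a * (k₁ * k) by
      rw [← hk3, hk₃]; simp only [mul_assoc, ha']) y
    simpa only [End.mul_apply, hky, map_neg, hk1y] using h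
  have k3 : k (a (a y)) = a (a y) := by
    have h := LinearMap.congr_fun (show k * (a * a) = a * (a * k₁) by
      rw [hk₁]; simp only [mul_assoc, ha']) y
    simpa only [End.mul_apply, hk1y] using h
  have k12 : k₁ (a y) = -(a y) := by
    have h := LinearMap.congr_fun (show k₁ * a = a * k by
      rw [hk₁]; simp only [mul_assoc, ha3, mul_one]) y
    simpa only [End.mul_apply, hky, map_neg] using h
  have by1 : b y = -(a (a y)) := by rw [B, hky, map_neg, map_neg]
  have by2 : b (a y) = -y := by rw [B, k2, map_neg, map_neg, A]
  have by3 : b (a (a y)) = a y := by rw [B, k3, A]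
  have key : ∀ u : V, u = -u → u = 0 := fun u hu => by
    have : (2 : K) • u = 0 := by rw [two_smul]; nth_rewrite 1 [hu]; exact neg_add_cancel u
    exact (smul_eq_zero.1 this).resolve_left two_ne_zero
  have ay0 : a y ≠ 0 := fun h => hw (by rw [← A, h, map_zero, map_zero])
  have aay0 : a (a y) ≠ 0 := fun h => hw (by rw [← A, h, map_zero])
  refine ⟨a (a y) - a y, ⟨a y, rfl⟩, ⟨-(a (a y)), ?_⟩, ?_, ?_, ?_⟩
  · rw [map_neg, by3]; abel
  · simp only [map_sub, A, by2, by3, map_neg]; abel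
  · simp only [map_sub, A, by2, by3]
    intro h
    have h1 : a (a y) = -(a y) := by
      have : a y - -y - (y - a (a y)) = a y + a (a y) := by abel
      rw [← h, sub_self] at this
      exact (neg_eq_of_add_eq_zero_right this.symm).symm
    have h2 := congrArg k h1
    rw [k3, map_neg, k2, h1] at h2
    exact ay0 (key _ (by simpa using h2.symm))
  · intro x z h
    simp only [map_sub, A] at h
    have h' := congrArg k h
    simp only [map_add, map_sub, map_smul, k2, k3, hky, map_zero] at h'
    have hx : (2 * x) • a (a y) = 0 := by
      calc (2 * x) • a (a y) = (x • (a (a y) - a y) + z • (a (a y) - a y + (y - a (a y)))) +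
            (x • (a (a y) - -(a y)) + z • (a (a y) - -(a y) + (-y - a (a y)))) := by module
        _ = 0 := by rw [h, h', add_zero]
    have hx0 : x = 0 := by simpa [aay0] using hx
    have h'' := congrArg k₁ h
    rw [hx0] at h h''
    simp only [sub_add_sub_cancel', zero_smul, zero_add, map_smul, map_sub, hk1y, k12, map_zero] at h h''
    have hz : (2 * z) • y = 0 := by
      calc (2 * z) • y = z • (y - a y) + z • (y - -(a y)) := by module
        _ = 0 := by rw [h, h'', add_zero]
    exact ⟨hx0, by simpa [hw] using hz⟩

/-- The permutation `i ↦ j ↦ k ↦ i`, for distinct `i`, `j`, `k`. -/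
def threeCycle {α : Type*} [DecidableEq α] (i j k : α) : Perm α := swap i j * swap j k

section threeCycle

variable {α : Type*} [DecidableEq α]

theorem threeCycle_apply_fst {i j k : α} (hij : i ≠ j) (hik : i ≠ k) : threeCycle i j k i = j := by
  simp [threeCycle, swap_apply_of_ne_of_ne hij hik]

theorem threeCycle_apply_snd {i j k : α} (hik : i ≠ k) (hjk : j ≠ k) : threeCycle i j k j = k := by
  simp [threeCycle, swap_apply_of_ne_of_ne hik.symm hjk.symm]

theorem threeCycle_apply_trd {i j k : α} : threeCycle i j k k = i := by
  simp [threeCycle]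

theorem threeCycle_apply_of_ne {i j k x : α} (hi : x ≠ i) (hj : x ≠ j) (hk : x ≠ k) :
    threeCycle i j k x = x := by
  simp [threeCycle, swap_apply_of_ne_of_ne hj hk, swap_apply_of_ne_of_ne hi hj]

theorem conj_threeCycle (τ : Perm α) (i j k : α) :
    τ * threeCycle i j k * τ⁻¹ = threeCycle (τ i) (τ j) (τ k) := by
  rw [threeCycle, threeCycle, swap_apply_apply, swap_apply_apply]
  group

theorem threeCycle_pow_three {i j k : α} (h : [i, j, k].Nodup) : threeCycle i j k ^ 3 = 1 := by
  simp only [List.nodup_cons, List.mem_cons, List.not_mem_nil, or_false, not_or] at h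
  obtain ⟨⟨hij, hik⟩, hjk, -⟩ := h
  ext x
  simp only [pow_three, Perm.mul_apply, Perm.one_apply]
  by_cases h1 : x = i
  · subst h1
    rw [threeCycle_apply_fst hij hik, threeCycle_apply_snd hik hjk, threeCycle_apply_trd]
  by_cases h2 : x = j
  · subst h2
    rw [threeCycle_apply_snd hik hjk, threeCycle_apply_trd, threeCycle_apply_fst hij hik]
  by_cases h3 : x = k
  · subst h3
    rw [threeCycle_apply_trd, threeCycle_apply_fst hij hik, threeCycle_apply_snd hik hjk]
  simp only [threeCycle_apply_of_ne h1 h2 h3]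

end threeCycle

theorem exists_notMem_list {α : Type*} [Fintype α] [DecidableEq α] (s : List α)
    (h : s.length < Fintype.card α) : ∃ x, x ∉ s := by
  by_contra! hcon
  have : (Finset.univ : Finset α) ⊆ s.toFinset := fun x _ => by simpa using hcon x
  have := Finset.card_le_card this
  rw [Finset.card_univ] at this
  exact absurd (this.trans s.toFinset_card_le) (by omega)

/-- A family of endomorphisms indexed by the three-cycles `i ↦ j ↦ k ↦ i`, behaving like a
nontrivial representation in which disjoint three-cycles act on complementary subspaces. -/
structure IsThreeCycleSystem {α K V : Type*} [DecidableEq α] [Field K] [AddCommGroup V]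
    [Module K V] (L : α → α → α → End K V) : Prop where
  pow_three : ∀ i j k, [i, j, k].Nodup → L i j k ^ 3 = 1
  conj : ∀ i j k p q r, [i, j, k].Nodup → [p, q, r].Nodup →
    L p q r * L i j k = L (threeCycle p q r i) (threeCycle p q r j) (threeCycle p q r k) * L p q r
  disj : ∀ i j k l m n, [i, j, k, l, m, n].Nodup → (L i j k - 1) * (L l m n - 1) = 0
  ne_one : ∀ i j k, [i, j, k].Nodup → L i j k ≠ 1
  sq : ∀ i j k l, [i, j, k, l].Nodup → (L i j k * L i j l) ^ 2 = 1

/-- A vector generating a copy of the reduced permutation module for the stabilizer of `o`. -/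
structure IsBaseVector {α K V : Type*} [Field K] [AddCommGroup V]
    [Module K V] (L : α → α → α → End K V) (o i z z' : α) (v : V) : Prop where
  nodup : [o, i, z, z'].Nodup
  eq_fst : ∃ w, v = L o i z w - w
  eq_snd : ∃ w, v = L o i z' w - w
  rel : L o i z v + L o i z (L o i z' v) = L o i z' v
  ne : L o i z v ≠ L o i z' v
  indep : ∀ x y : K, x • v + y • (v + L o i z v) = 0 → x = 0 ∧ y = 0

section IsThreeCycleSystem

variable {α K V : Type*} [DecidableEq α] [Field K] [AddCommGroup V] [Module K V]
  {L : α → α → α → End K V}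

namespace IsThreeCycleSystem

theorem apply_sub (hL : IsThreeCycleSystem L) {i j k l m n : α} (h : [i, j, k, l, m, n].Nodup)
    (w : V) : L i j k (L l m n w - w) = L l m n w - w := by
  have := LinearMap.congr_fun (hL.disj i j k l m n h) w
  simpa [sub_eq_zero] using this

theorem apply_apply_apply (hL : IsThreeCycleSystem L) {i j k : α} (h : [i, j, k].Nodup) (u : V) :
    L i j k (L i j k (L i j k u)) = u := by
  have := LinearMap.congr_fun (hL.pow_three i j k h) u
  simpa [_root_.pow_three] using this

theorem apply_apply (hL : IsThreeCycleSystem L) {o i j p q r : α} (h : [o, i, j].Nodup)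
    (h' : [o, i, p, q, r].Nodup) (u : V) :
    L p q r (L o i j u) = L o i (threeCycle p q r j) (L p q r u) := by
  have := LinearMap.congr_fun (hL.conj o i j p q r h (by grind)) u
  rwa [threeCycle_apply_of_ne (x := o) (by grind) (by grind) (by grind),
    threeCycle_apply_of_ne (x := i) (by grind) (by grind) (by grind)] at this

theorem apply_apply_eq_rotate (hL : IsThreeCycleSystem L) {o i x y w : α}
    (hn : [o, i, x, y, w].Nodup) (hxy : ∀ u, L o i x (L o i y u) = u) (u : V) :
    L o i y (L o i w u) = u := by
  have h1 := congrArg (L x y w) (hxy (L x y w (L x y w u)))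
  clear hxy
  rwa [hL.apply_apply (j := x) (by grind) (by grind), hL.apply_apply (j := y) (by grind) (by grind),
    hL.apply_apply_apply (by grind), threeCycle_apply_fst (by grind) (by grind),
    threeCycle_apply_snd (by grind) (by grind)] at h1

theorem mul_ne_one (hL : IsThreeCycleSystem L) {o i z z' t : α} (hn : [o, i, z, z', t].Nodup) :
    L o i z * L o i z' ≠ 1 := by
  intro h
  have h1 : ∀ u, L o i z (L o i z' u) = u := fun u => LinearMap.congr_fun h u
  have h2 := hL.apply_apply_eq_rotate hn h1
  have h3 := hL.apply_apply_eq_rotate (w := z) (by clear h h1 h2; grind) h2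
  have hn' : [o, i, z].Nodup := by clear h h1 h2 h3; grind
  refine hL.ne_one o i z hn' (LinearMap.ext fun u => ?_)
  have h4 : ∀ u, L o i z u = L o i t u := fun u => by
    have := h1 (L o i t u)
    rwa [h2] at this
  have h5 := hL.apply_apply_apply hn' u
  rwa [h4 (L o i z u), h3] at h5

theorem exists_isBaseVector [CharZero K] (hL : IsThreeCycleSystem L) {o i z z' t : α}
    (hn : [o, i, z, z', t].Nodup) : ∃ v, IsBaseVector L o i z z' v := by
  obtain ⟨v, hw, hw', hrel, hne, hind⟩ := exists_tetrahedral_vector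
    (hL.pow_three o i z (by grind)) (hL.pow_three o i z' (by grind)) (hL.sq o i z z' (by grind))
    (hL.mul_ne_one hn)
  exact ⟨v, by grind, hw, hw', hrel, hne, hind⟩

end IsThreeCycleSystem

namespace IsBaseVector

variable [Fintype α] {o i z z' : α} {v : V}

theorem exists_eq_sub (hv : IsBaseVector L o i z z' v) (hL : IsThreeCycleSystem L)
    (hcard : 8 ≤ Fintype.card α) {m : α} (hm : [o, i, m].Nodup) : ∃ w, v = L o i m w - w := by
  have hn := hv.nodup
  by_cases hmz : m = z
  · exact hmz ▸ hv.eq_fst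
  by_cases hmz' : m = z'
  · exact hmz' ▸ hv.eq_snd
  obtain ⟨p, hp⟩ := exists_notMem_list [o, i, z, z', m] (by simp; omega)
  obtain ⟨w, hw⟩ := hv.eq_fst
  obtain ⟨w', hw'⟩ := hv.eq_snd
  refine ⟨L z m p w, ?_⟩
  have h1 : L z m p v = v := by
    rw [hw']; exact hL.apply_sub (by clear hw hw'; grind) _
  conv_lhs => rw [← h1, hw]
  clear h1 hw hw'
  rw [map_sub, hL.apply_apply (by grind) (by grind), threeCycle_apply_fst (by grind) (by grind)]

theorem apply_eq (hv : IsBaseVector L o i z z' v) (hL : IsThreeCycleSystem L)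
    (hcard : 8 ≤ Fintype.card α) {j k l : α} (h : [o, i, j, k, l].Nodup) : L j k l v = v := by
  obtain ⟨m, hm⟩ := exists_notMem_list [o, i, j, k, l] (by simp; omega)
  obtain ⟨w, hw⟩ := hv.exists_eq_sub hL hcard (m := m) (by grind)
  rw [hw]; exact hL.apply_sub (by clear hw; grind) _

theorem apply_apply (hv : IsBaseVector L o i z z' v) (hL : IsThreeCycleSystem L)
    (hcard : 8 ≤ Fintype.card α) {j k l x : α} (h : [o, i, j, k, l].Nodup) (hx : [o, i, x].Nodup) :
    L j k l (L o i x v) = L o i (threeCycle j k l x) v := by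
  rw [hL.apply_apply hx h, hv.apply_eq hL hcard h]

theorem apply_add_apply (hv : IsBaseVector L o i z z' v) (hL : IsThreeCycleSystem L)
    (hcard : 8 ≤ Fintype.card α) {j : α} (h : [o, i, z, j].Nodup) :
    L o i z v + L o i z (L o i j v) = L o i j v := by
  have hn := hv.nodup
  by_cases hj : j = z'
  · rw [hj, hv.rel]
  obtain ⟨p, hp⟩ := exists_notMem_list [o, i, z, z', j] (by simp; omega)
  have hp' : [o, i, z', j, p].Nodup := by grind
  have hz : threeCycle z' j p z = z :=
    threeCycle_apply_of_ne (by grind) (by grind) (by grind)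
  have hz' : threeCycle z' j p z' = j := threeCycle_apply_fst (by grind) (by grind)
  have h1 : L z' j p (L o i z v) = L o i z v := by
    rw [hv.apply_apply hL hcard hp' (by grind), hz]
  have h2 : L z' j p (L o i z' v) = L o i j v := by
    rw [hv.apply_apply hL hcard hp' (by clear h1; grind), hz']
  have h3 := congrArg (L z' j p) hv.rel
  rwa [map_add, h1, h2, hL.apply_apply (by clear h1 h2 h3; grind) hp', h2, hz] at h3

theorem apply_ne (hv : IsBaseVector L o i z z' v) (hL : IsThreeCycleSystem L)
    (hcard : 8 ≤ Fintype.card α) {j k : α} (h : [o, i, j, k].Nodup) : L o i j v ≠ L o i k v := by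
  intro heq
  have hn := hv.nodup
  have hall : ∀ t, [o, i, t].Nodup → L o i t v = L o i j v := by
    intro t ht
    by_cases htj : t = j
    · rw [htj]
    by_cases htk : t = k
    · rw [htk, heq]
    obtain ⟨p, hp⟩ := exists_notMem_list [o, i, j, k, t] (by simp; omega)
    have h1 := congrArg (L k t p) heq
    clear heq
    rw [hv.apply_apply hL hcard (by clear h1; grind) (by clear h1; grind),
      hv.apply_apply hL hcard (by clear h1; grind) (by clear h1; grind),
      threeCycle_apply_of_ne (by clear h1; grind) (by clear h1; grind) (by clear h1; grind),
      threeCycle_apply_fst (by clear h1; grind) (by clear h1; grind)] at h1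
    exact h1.symm
  have h1 : [o, i, z].Nodup := by clear hall heq; grind
  have h2 : [o, i, z'].Nodup := by clear hall heq; grind
  exact hv.ne ((hall z h1).trans (hall z' h2).symm)

theorem coeff_eq (hv : IsBaseVector L o i z z' v) (hL : IsThreeCycleSystem L)
    (hcard : 8 ≤ Fintype.card α) {x : K} {y : α → K}
    (hxy : x • v + ∑ m ∈ (Finset.univ.erase o).erase i, y m • (v + L o i m v) = 0) {k l : α}
    (hkl : [o, i, k, l].Nodup) : y k = y l := by
  obtain ⟨j, hj⟩ := exists_notMem_list [o, i, k, l] (by simp; omega)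
  obtain ⟨m, hm⟩ := exists_notMem_list [o, i, k, l, j] (by simp; omega)
  obtain ⟨p, hp⟩ := exists_notMem_list [o, i, k, l, j, m] (by simp; omega)
  have hn : [o, i, k, l, j, m, p].Nodup := by clear hxy; grind
  clear hkl hj hm hp
  have key : y j • (L o i k v - L o i j v) + y k • (L o i l v - L o i k v) +
      y l • (L o i j v - L o i l v) = 0 := by
    have hn' : [o, i, j, k, l].Nodup := by clear hxy; grind
    have h1 := congrArg (L j k l) hxy
    rw [map_zero, ← hxy, ← sub_eq_zero, map_add, map_sum, map_smul, hv.apply_eq hL hcard hn',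
      add_sub_add_left_eq_sub, ← Finset.sum_sub_distrib] at h1
    have h2 : ∀ t ∈ (Finset.univ.erase o).erase i,
        L j k l (y t • (v + L o i t v)) - y t • (v + L o i t v) =
          y t • (L o i (threeCycle j k l t) v - L o i t v) := by
      intro t ht
      have ht' : [o, i, t].Nodup := by
        simp only [Finset.mem_erase, Finset.mem_univ, and_true] at ht
        clear hxy h1; grind
      rw [map_smul, map_add, hv.apply_eq hL hcard hn', hv.apply_apply hL hcard hn' ht',
        ← smul_sub, add_sub_add_left_eq_sub]
    rw [Finset.sum_congr rfl h2] at h1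
    have h3 : ({j, k, l} : Finset α) ⊆ (Finset.univ.erase o).erase i := by
      clear hxy h1 h2; intro t; simp; grind
    rw [← Finset.sum_subset h3, Finset.sum_insert, Finset.sum_insert, Finset.sum_singleton,
      threeCycle_apply_fst, threeCycle_apply_snd, threeCycle_apply_trd, ← add_assoc] at h1
    · exact h1
    · clear hxy h1 h2; grind
    · clear hxy h1 h2; grind
    · clear hxy h1 h2; grind
    · clear hxy h1 h2; grind
    · clear hxy h1 h2; grind
    · clear hxy h1 h2; grind
    · intro t _ ht
      simp only [Finset.mem_insert, Finset.mem_singleton, not_or] at ht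
      rw [threeCycle_apply_of_ne ht.1 ht.2.1 ht.2.2, sub_self, smul_zero]
  clear hxy
  simp only [List.nodup_cons, List.mem_cons, List.not_mem_nil, or_false, not_or] at hn
  have h1 := congrArg (L l m p) key
  rw [map_zero, ← key] at h1
  clear key
  have h2 : L l m p (L o i j v) = L o i j v := by
    rw [hv.apply_apply hL hcard (by clear h1; grind) (by clear h1; grind),
      threeCycle_apply_of_ne (by clear h1; grind) (by clear h1; grind) (by clear h1; grind)]
  have h3 : L l m p (L o i k v) = L o i k v := by
    rw [hv.apply_apply hL hcard (by clear h1; grind) (by clear h1; grind),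
      threeCycle_apply_of_ne (by clear h1; grind) (by clear h1; grind) (by clear h1; grind)]
  have h4 : L l m p (L o i l v) = L o i m v := by
    rw [hv.apply_apply hL hcard (by clear h1; grind) (by clear h1; grind),
      threeCycle_apply_fst (by clear h1; grind) (by clear h1; grind)]
  simp only [map_add, map_smul, map_sub, h2, h3, h4] at h1
  have h5 : (y k - y l) • (L o i m v - L o i l v) = 0 := by
    rw [← sub_eq_zero] at h1
    rw [← h1]
    module
  have h6 := hv.apply_ne hL hcard (j := m) (k := l) (by clear h1 h2 h3 h4 h5; grind)
  exact sub_eq_zero.1 ((smul_eq_zero.1 h5).resolve_right (sub_ne_zero.2 h6))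

theorem coeff_eq_zero [CharZero K] (hv : IsBaseVector L o i z z' v) (hL : IsThreeCycleSystem L)
    (hcard : 8 ≤ Fintype.card α) {x : K} {y : α → K}
    (hxy : x • v + ∑ m ∈ (Finset.univ.erase o).erase i, y m • (v + L o i m v) = 0) :
    x = 0 ∧ ∀ m ∈ (Finset.univ.erase o).erase i, y m = 0 := by
  have hn := hv.nodup
  have hy : ∀ m ∈ (Finset.univ.erase o).erase i, y m = y z := by
    intro m hm
    by_cases hmz : m = z
    · rw [hmz]
    · refine hv.coeff_eq hL hcard hxy ?_
      simp only [Finset.mem_erase, Finset.mem_univ, and_true] at hm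
      clear hxy; grind
  obtain ⟨c, hc⟩ : ∃ c, c = y z := ⟨_, rfl⟩
  rw [← hc] at hy
  rw [Finset.sum_congr rfl fun m hm => by rw [hy m hm]] at hxy
  have hz : z ∈ (Finset.univ.erase o).erase i := by
    simp only [Finset.mem_erase, Finset.mem_univ, and_true]
    clear hxy hy; grind
  rw [← Finset.add_sum_erase _ _ hz] at hxy
  set S := ((Finset.univ.erase o).erase i).erase z with hS
  have hnz : [o, i, z].Nodup := by clear hxy hy; grind
  have ha : L o i z v + L o i z (L o i z v) = -v := by
    obtain ⟨w, hw⟩ := hv.eq_fst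
    rw [hw, map_sub, map_sub, hL.apply_apply_apply hnz]
    abel
  have h1 := congrArg (L o i z) hxy
  have h2 : ∀ m ∈ S, L o i z (c • (v + L o i m v)) = c • (v + L o i m v) - c • v := by
    intro m hm
    have : [o, i, z, m].Nodup := by
      simp only [hS, Finset.mem_erase, Finset.mem_univ, and_true] at hm
      clear hxy h1 hy ha; grind
    rw [map_smul, map_add, hv.apply_add_apply hL hcard this]
    module
  rw [map_zero, ← hxy, map_add, map_add, map_sum, Finset.sum_congr rfl h2, Finset.sum_sub_distrib,
    Finset.sum_const, map_smul, map_smul, map_add, ha, ← sub_eq_zero] at h1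
  have h3 : (2 * x + (S.card + 1) * c) • v + (c - x) • (v + L o i z v) = 0 := by
    rw [← neg_eq_zero, ← h1, ← Nat.cast_smul_eq_nsmul K]
    module
  obtain ⟨h4, h5⟩ := hv.indep _ _ h3
  rw [sub_eq_zero] at h5
  subst h5
  have h6 : ((S.card + 3 : ℕ) : K) * c = 0 := by
    push_cast
    linear_combination h4
  have h7 : c = 0 := (mul_eq_zero.1 h6).resolve_left (Nat.cast_ne_zero.2 (by omega))
  exact ⟨h7, fun m hm => (hy m hm).trans h7⟩

theorem card_le_finrank_add_one [CharZero K] [FiniteDimensional K V]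
    (hv : IsBaseVector L o i z z' v) (hL : IsThreeCycleSystem L) (hcard : 8 ≤ Fintype.card α) :
    Fintype.card α ≤ finrank K V + 1 := by
  have hio : i ∈ Finset.univ.erase o := by
    have := hv.nodup
    simp only [Finset.mem_erase, Finset.mem_univ, and_true]
    grind
  have hind : LinearIndepOn K (fun m => if m = i then v else v + L o i m v)
      (Finset.univ.erase o : Finset α) := by
    rw [linearIndepOn_finset_iff]
    intro y hy
    rw [← Finset.add_sum_erase _ _ hio, if_pos rfl, Finset.sum_congr rfl fun m hm => by
      rw [if_neg (Finset.ne_of_mem_erase hm)]] at hy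
    obtain ⟨h1, h2⟩ := hv.coeff_eq_zero hL hcard hy
    intro m hm
    by_cases hmi : m = i
    · rw [hmi, h1]
    · exact h2 m (Finset.mem_erase.2 ⟨hmi, hm⟩)
  have := hind.fintype_card_le_finrank
  simp only [SetLike.coe_sort_coe, Fintype.card_coe] at this
  rw [Finset.card_erase_of_mem (Finset.mem_univ _), Finset.card_univ] at this
  omega

end IsBaseVector

theorem IsThreeCycleSystem.card_le_finrank_add_one [CharZero K] [FiniteDimensional K V] [Fintype α]
    (hL : IsThreeCycleSystem L) (hcard : 8 ≤ Fintype.card α) :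
    Fintype.card α ≤ finrank K V + 1 := by
  obtain ⟨s, hs, hs'⟩ : ∃ s : List α, s.Nodup ∧ s.length = 5 := by
    obtain ⟨s, hs⟩ := Finset.exists_subset_card_eq (s := (Finset.univ : Finset α)) (n := 5)
      (by rw [Finset.card_univ]; omega)
    exact ⟨s.toList, s.nodup_toList, by simp [hs.2]⟩
  match s, hs' with
  | [o, i, z, z', t], _ =>
    obtain ⟨v, hv⟩ := hL.exists_isBaseVector hs
    exact hv.card_le_finrank_add_one hL hcard

end IsThreeCycleSystem

theorem viaEmbedding_unique {α β : Type*} {σ : Perm α} {f : α ↪ β} {τ : Perm β}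
    (h : ∀ x, τ (f x) = f (σ x)) (h' : ∀ y, y ∉ Set.range f → τ y = y) :
    τ = σ.viaEmbedding f := by
  ext y
  by_cases hy : y ∈ Set.range f
  · obtain ⟨x, rfl⟩ := hy
    rw [h, viaEmbedding_apply]
  · rw [h' y hy, viaEmbedding_apply_of_notMem _ _ _ hy]

theorem viaEmbedding_trans {α β γ : Type*} (σ : Perm α) (g : α ↪ β) (f : β ↪ γ) :
    (σ.viaEmbedding g).viaEmbedding f = σ.viaEmbedding (g.trans f) := by
  apply viaEmbedding_unique
  · intro x
    simp only [Function.Embedding.trans_apply, viaEmbedding_apply]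
  · intro y hy
    by_cases h : y ∈ Set.range f
    · obtain ⟨x, rfl⟩ := h
      rw [viaEmbedding_apply, viaEmbedding_apply_of_notMem]
      rintro ⟨z, rfl⟩
      exact hy ⟨z, rfl⟩
    · exact viaEmbedding_apply_of_notMem _ _ _ h

theorem viaEmbedding_toEmbedding {α : Type*} (σ e : Perm α) :
    σ.viaEmbedding e.toEmbedding = e * σ * e⁻¹ := by
  symm
  apply viaEmbedding_unique
  · intro x; simp
  · intro y hy; exact absurd ⟨e⁻¹ y, by simp⟩ hy

theorem viaEmbedding_swap {α β : Type*} [DecidableEq α] [DecidableEq β] (f : α ↪ β) (i j : α) :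
    (swap i j).viaEmbedding f = swap (f i) (f j) := by
  symm
  apply viaEmbedding_unique
  · intro x; exact f.injective.swap_apply i j x
  · intro y hy
    exact swap_apply_of_ne_of_ne (fun h => hy ⟨i, h.symm⟩) (fun h => hy ⟨j, h.symm⟩)

theorem viaEmbedding_mul {α β : Type*} (f : α ↪ β) (σ τ : Perm α) :
    (σ * τ).viaEmbedding f = σ.viaEmbedding f * τ.viaEmbedding f :=
  map_mul (viaEmbeddingHom f) σ τ

theorem viaEmbedding_one {α β : Type*} (f : α ↪ β) : (1 : Perm α).viaEmbedding f = 1 :=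
  map_one (viaEmbeddingHom f)

theorem viaEmbedding_threeCycle {α β : Type*} [DecidableEq α] [DecidableEq β] (f : α ↪ β)
    (i j k : α) : (threeCycle i j k).viaEmbedding f = threeCycle (f i) (f j) (f k) := by
  rw [threeCycle, viaEmbedding_mul, viaEmbedding_swap, viaEmbedding_swap, threeCycle]

theorem sign_viaEmbedding {α β : Type*} [Fintype α] [DecidableEq α] [Fintype β] [DecidableEq β]
    (f : α ↪ β) (σ : Perm α) : sign (σ.viaEmbedding f) = sign σ := by
  classical
  rw [viaEmbedding]
  convert sign_extendDomain σ (ofInjective f.1 f.2)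

theorem IsSignedHom.viaEmbedding {α β R : Type*} [Fintype α] [DecidableEq α] [Fintype β]
    [DecidableEq β] [Ring R] {T : Perm β → R} (hT : IsSignedHom T) (f : α ↪ β) :
    IsSignedHom fun σ : Perm α => T (σ.viaEmbedding f) where
  one := by rw [viaEmbedding_one]; exact hT.one
  mul σ τ hσ hτ := by
    rw [viaEmbedding_mul]
    exact hT.mul _ _ (by rw [sign_viaEmbedding, hσ]) (by rw [sign_viaEmbedding, hτ])

theorem exists_embedding_of_nodup {α : Type*} [Fintype α] {n : ℕ} (hα : n ≤ Fintype.card α)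
    {s : List α} (hs : s.Nodup) (hn : s.length ≤ n) :
    ∃ f : Fin n ↪ α, ∀ (i : ℕ) (h : i < s.length), f ⟨i, h.trans_le hn⟩ = s[i] := by
  obtain ⟨f, hf⟩ := Fin.Embedding.restrictSurjective_of_le_natCard hn
    (by rwa [Nat.card_eq_fintype_card]) ⟨s.get, List.nodup_iff_injective_get.1 hs⟩
  exact ⟨f, fun i h => DFunLike.congr_fun hf ⟨i, h⟩⟩

theorem mul_pow_sub_one_eq_zero {R : Type*} [Ring R] {x p q : R} (hp : x * (p - 1) = 0)
    (hq : x * (q - 1) = 0) (k : ℕ) : x * ((p * q) ^ k - 1) = 0 := by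
  rw [mul_sub, mul_one, sub_eq_zero] at *
  induction k with
  | zero => simp
  | succ k ih => rw [pow_succ, ← mul_assoc, ih, ← mul_assoc, hp, hq]

theorem pow_sub_one_mul_eq_zero {R : Type*} [Ring R] {x p q : R} (hp : (p - 1) * x = 0)
    (hq : (q - 1) * x = 0) (k : ℕ) : ((p * q) ^ k - 1) * x = 0 := by
  rw [sub_mul, one_mul, sub_eq_zero] at *
  induction k with
  | zero => simp
  | succ k ih => rw [pow_succ, mul_assoc, mul_assoc, hq, hp, ih]

/-- A `5`-cycle on ten letters. -/
def fiveCycleLeft : Perm (Fin 10) := [0, 1, 2, 6, 7].formPerm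

/-- A `5`-cycle on ten letters, disjoint from `fiveCycleLeft`. -/
def fiveCycleRight : Perm (Fin 10) := [3, 4, 5, 8, 9].formPerm

theorem oddLift_threeCycle_disjoint {R : Type*} [Ring R] {T : Perm (Fin 10) → R}
    (hT : IsSignedHom T)
    (h : ∀ e : Perm (Fin 10), (oddLift T (e * fiveCycleLeft * e⁻¹) - 1) *
      (oddLift T (e * fiveCycleRight * e⁻¹) - 1) = 0) :
    (oddLift T (threeCycle 0 1 2) - 1) * (oddLift T (threeCycle 3 4 5) - 1) = 0 := by
  have key : ∀ s ∈ [[0, 2, 1, 6, 7], [0, 2, 7, 6, 1]], ∀ s' ∈ [[3, 5, 4, 8, 9], [3, 5, 9, 8, 4]],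
      (oddLift T (List.formPerm s) - 1) * (oddLift T (List.formPerm s') - 1) = 0 := by
    intro s hs s' hs'
    let e : Perm (Fin 10) := (if s = [0, 2, 1, 6, 7] then swap 1 2 else swap 1 2 * swap 2 7) *
      (if s' = [3, 5, 4, 8, 9] then swap 4 5 else swap 4 5 * swap 5 9)
    have h1 : e * fiveCycleLeft * e⁻¹ = List.formPerm s := by revert s s'; decide +kernel
    have h2 : e * fiveCycleRight * e⁻¹ = List.formPerm s' := by revert s s'; decide +kernel
    rw [← h1, ← h2]
    exact h e
  have hs : threeCycle 0 1 2 = List.formPerm [0, 2, 1, 6, 7] *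
    (List.formPerm [0, 2, 7, 6, 1] : Perm (Fin 10)) := by decide +kernel
  have hs' : threeCycle 3 4 5 = List.formPerm [3, 5, 4, 8, 9] *
    (List.formPerm [3, 5, 9, 8, 4] : Perm (Fin 10)) := by decide +kernel
  rw [hs, hs', hT.oddLift_mul (by decide +kernel) (by decide +kernel) (by decide +kernel)
    (by decide +kernel), hT.oddLift_mul (by decide +kernel) (by decide +kernel) (by decide +kernel)
    (by decide +kernel)]
  apply pow_sub_one_mul_eq_zero <;> apply mul_pow_sub_one_eq_zero <;> apply key <;> simp

theorem sign_threeCycle {α : Type*} [Fintype α] [DecidableEq α] {i j k : α}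
    (h : [i, j, k].Nodup) : sign (threeCycle i j k) = 1 := by
  rw [threeCycle, Perm.sign_mul, sign_swap (by grind), sign_swap (by grind)]
  rfl

theorem threeCycle_pow_sixteen {α : Type*} [DecidableEq α] {i j k : α} (h : [i, j, k].Nodup) :
    threeCycle i j k ^ 16 = threeCycle i j k := by
  rw [show 16 = 3 * 5 + 1 from rfl, pow_succ, pow_mul, threeCycle_pow_three h, one_pow, one_mul]

theorem isThreeCycle_threeCycle {α : Type*} [Fintype α] [DecidableEq α] {i j k : α}
    (h : [i, j, k].Nodup) : (threeCycle i j k).IsThreeCycle := by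
  rw [threeCycle, swap_comm i j]
  exact isThreeCycle_swap_mul_swap_same (by grind) (by grind) (by grind)

namespace IsSignedHom

variable {α R : Type*} [DecidableEq α] [Fintype α] [Ring R] {T : Perm α → R}

theorem oddLift_eq_one_of_conj (hT : IsSignedHom T) {σ τ : Perm α} (hσ : sign σ = 1)
    (hτ : sign τ = 1) (h : oddLift T σ = 1) : oddLift T (τ * σ * τ⁻¹) = 1 := by
  have h1 := hT.conj hσ hτ
  have h2 := hT.isUnit (σ := τ⁻¹) (by simp [hτ])
  rw [inv_inv] at h2
  rw [h, mul_one] at h1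
  have h3 := congrArg (· * T τ⁻¹) h1
  rw [mul_assoc] at h3
  rcases h2 with h2 | h2 <;> rw [h2] at h3
  · simpa using h3.symm
  · simpa [neg_eq_iff_eq_neg] using h3.symm

theorem oddLift_threeCycle_ne_one (hT : IsSignedHom T) (hα : 5 ≤ Fintype.card α)
    (hg : ∃ g : Fin 5 ↪ α, oddLift T ((finRotate 5).viaEmbedding g) ≠ 1) {i j k : α}
    (h : [i, j, k].Nodup) : oddLift T (threeCycle i j k) ≠ 1 := by
  intro h1
  obtain ⟨g, hg⟩ := hg
  have hall : ∀ p q r, [p, q, r].Nodup → oddLift T (threeCycle p q r) = 1 := by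
    intro p q r h'
    have := alternatingGroup.isThreeCycle_isConj (by rwa [Nat.card_eq_fintype_card])
      (σ := ⟨_, sign_threeCycle h⟩) (τ := ⟨_, sign_threeCycle h'⟩)
      (isThreeCycle_threeCycle h) (isThreeCycle_threeCycle h')
    obtain ⟨⟨c, hc⟩, hc'⟩ := isConj_iff.1 this
    have hc'' : c * threeCycle i j k * c⁻¹ = threeCycle p q r := congrArg Subtype.val hc'
    rw [← hc'']
    exact hT.oddLift_eq_one_of_conj (sign_threeCycle h) hc h1
  apply hg
  rw [show finRotate 5 = threeCycle 0 1 2 * threeCycle 2 3 4 by decide +kernel, viaEmbedding_mul,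
    viaEmbedding_threeCycle, viaEmbedding_threeCycle]
  have hn : [g 0, g 1, g 2].Nodup := by simp [g.injective.eq_iff]
  have hn' : [g 2, g 3, g 4].Nodup := by simp [g.injective.eq_iff]
  rw [hT.oddLift_mul (sign_threeCycle hn) (threeCycle_pow_sixteen hn) (sign_threeCycle hn')
    (threeCycle_pow_sixteen hn'), hall _ _ _ hn, hall _ _ _ hn', one_mul, one_pow]

theorem oddLift_mul_oddLift_sq (hT : IsSignedHom T) {σ τ : Perm α} (hσ : sign σ = 1)
    (h : σ ^ 16 = σ) (hτ : sign τ = 1) (h' : τ ^ 16 = τ) (h2 : (σ * τ) ^ 2 = 1) :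
    (oddLift T σ * oddLift T τ) ^ 2 = 1 ∨ (oddLift T σ * oddLift T τ) ^ 2 = -1 := by
  have h3 : (oddLift T σ * oddLift T τ) ^ 2 = T (σ * τ) ^ 2 := by
    rcases hT.mul σ τ hσ hτ with h₁ | h₁ <;> rcases hT.eq_oddLift hσ h with h₂ | h₂ <;>
      rcases hT.eq_oddLift hτ h' with h₃ | h₃ <;> simp [h₁, h₂, h₃]
  have h4 := hT.pow (σ := σ * τ) (by simp [hσ, hτ]) 2
  rw [h2] at h4
  rw [h3]
  rcases h4 with h4 | h4 <;> rcases hT.one with h5 | h5 <;> rw [h4] at h5 <;>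
    simp_all [neg_eq_iff_eq_neg]

theorem isThreeCycleSystem {K V : Type*} [Field K] [CharZero K] [AddCommGroup V] [Module K V]
    {T : Perm α → End K V} (hT : IsSignedHom T) (hα : 10 ≤ Fintype.card α)
    (hg : ∃ g : Fin 5 ↪ α, oddLift T ((finRotate 5).viaEmbedding g) ≠ 1)
    (h : ∀ f : Fin 10 ↪ α, (oddLift T (fiveCycleLeft.viaEmbedding f) - 1) *
      (oddLift T (fiveCycleRight.viaEmbedding f) - 1) = 0) :
    IsThreeCycleSystem fun i j k => oddLift T (threeCycle i j k) := by
  have hdisj : ∀ i j k l m n, [i, j, k, l, m, n].Nodup →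
      (oddLift T (threeCycle i j k) - 1) * (oddLift T (threeCycle l m n) - 1) = 0 := by
    intro i j k l m n hn
    obtain ⟨f, hf⟩ := exists_embedding_of_nodup hα hn (by simp)
    have := oddLift_threeCycle_disjoint (hT.viaEmbedding f) fun e => by
      simpa only [← viaEmbedding_toEmbedding, viaEmbedding_trans, oddLift] using
        h (e.toEmbedding.trans f)
    simp only [oddLift, viaEmbedding_threeCycle] at this
    have h0 : f 0 = i := hf 0 (by simp)
    have h1 : f 1 = j := hf 1 (by simp)
    have h2 : f 2 = k := hf 2 (by simp)
    have h3 : f 3 = l := hf 3 (by simp)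
    have h4 : f 4 = m := hf 4 (by simp)
    have h5 : f 5 = n := hf 5 (by simp)
    rwa [h0, h1, h2, h3, h4, h5] at this
  refine ⟨?_, ?_, hdisj, fun i j k => hT.oddLift_threeCycle_ne_one (by omega) hg, ?_⟩
  · intro i j k hn
    exact hT.oddLift_pow_eq_one (sign_threeCycle hn) (threeCycle_pow_three hn)
  · intro i j k p q r hn hn'
    have := hT.oddLift_conj (sign_threeCycle hn) (sign_threeCycle hn') (threeCycle_pow_sixteen hn')
    rwa [conj_threeCycle] at this
  · intro i j k l hn
    have hijk : [i, j, k].Nodup := by grind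
    have hijl : [i, j, l].Nodup := by grind
    refine (hT.oddLift_mul_oddLift_sq (sign_threeCycle hijk) (threeCycle_pow_sixteen hijk)
      (sign_threeCycle hijl) (threeCycle_pow_sixteen hijl) ?_).resolve_right fun h1 => ?_
    · obtain ⟨f, hf⟩ := exists_embedding_of_nodup hα hn (by simp)
      have h0 : f 0 = i := hf 0 (by simp)
      have h1 : f 1 = j := hf 1 (by simp)
      have h2 : f 2 = k := hf 2 (by simp)
      have h3 : f 3 = l := hf 3 (by simp)
      rw [← h0, ← h1, ← h2, ← h3, ← viaEmbedding_threeCycle, ← viaEmbedding_threeCycle,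
        ← viaEmbedding_mul, sq, ← viaEmbedding_mul]
      convert viaEmbedding_one f
      decide +kernel
    · obtain ⟨p, hp⟩ := exists_notMem_list [i, j, k, l] (by simp; omega)
      obtain ⟨q, hq⟩ := exists_notMem_list [i, j, k, l, p] (by simp; omega)
      obtain ⟨r, hr⟩ := exists_notMem_list [i, j, k, l, p, q] (by simp; omega)
      have hn' : [i, j, k, l, p, q, r].Nodup := by clear h1 hdisj h hg; grind
      have hpqr : [p, q, r].Nodup := by clear h1 hdisj h hg; grind
      have hY := pow_sub_one_mul_eq_zero (hdisj i j k p q r (by clear h1 hdisj h hg; grind))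
        (hdisj i j l p q r (by clear h1 hdisj h hg; grind)) 2
      rw [h1] at hY
      have hY' : (oddLift T (threeCycle p q r) - 1) = 0 := by
        have : (2 : K) • (oddLift T (threeCycle p q r) - 1) = 0 := by
          rw [two_smul, ← neg_eq_zero, ← hY]; noncomm_ring
        exact (smul_eq_zero.1 this).resolve_left two_ne_zero
      exact hT.oddLift_threeCycle_ne_one (by omega) hg hpqr (sub_eq_zero.1 hY')

end IsSignedHom

theorem exists_eigenvector_of_mul_ne_zero {K V : Type*} [Field K] [AddCommGroup V] [Module K V]
    [CharZero K] [IsAlgClosed K] [FiniteDimensional K V] {p q : End K V} (hp : p ^ 5 = 1)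
    (hpq : Commute p q) (h : (p - 1) * (q - 1) ≠ 0) :
    ∃ l : K, l ^ 5 = 1 ∧ l ≠ 1 ∧ ∃ v, p v = l • v ∧ q v ≠ v := by
  obtain ⟨l, hl, v, hv, hXv⟩ := exists_eigenvector_apply_ne_zero hp h
  refine ⟨l, hl, ?_, v, hv, ?_⟩
  · rintro rfl
    rw [((hpq.sub_left (.one_left _)).sub_right (.one_right _)).eq] at hXv
    simp [hv] at hXv
  · intro hqv
    simp [hqv] at hXv

theorem exists_sign_eq_one_conj_fiveCycleLeft_pow {k : ℕ} (hk : ¬ 5 ∣ k) :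
    ∃ τ : Perm (Fin 10), sign τ = 1 ∧ τ * fiveCycleLeft ^ k * τ⁻¹ = fiveCycleLeft := by
  have h : ∃ τ : Perm (Fin 10), sign τ = 1 ∧ τ * fiveCycleLeft ^ (k % 5) * τ⁻¹ = fiveCycleLeft := by
    have h1 : k % 5 < 5 := Nat.mod_lt _ (by norm_num)
    have h2 : k % 5 ≠ 0 := fun h => hk (Nat.dvd_of_mod_eq_zero h)
    generalize k % 5 = r at h1 h2
    interval_cases r
    · exact absurd rfl h2
    · exact ⟨1, by decide +kernel⟩
    · exact ⟨List.formPerm [2, 1, 6, 7] * swap 3 4, by decide +kernel⟩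
    · exact ⟨List.formPerm [6, 1, 2, 7] * swap 3 4, by decide +kernel⟩
    · exact ⟨swap 7 1 * swap 6 2, by decide +kernel⟩
  obtain ⟨τ, h1, h2⟩ := h
  refine ⟨τ, h1, ?_⟩
  rw [← Nat.div_add_mod k 5, pow_add, pow_mul,
    show fiveCycleLeft ^ 5 = 1 by decide +kernel, one_pow, one_mul, h2]

namespace IsSignedHom

variable {α K V : Type*} [DecidableEq α] [Fintype α] [Field K] [AddCommGroup V] [Module K V]

theorem oddLift_apply_conj {T : Perm α → End K V} (hT : IsSignedHom T) {σ σ' τ : Perm α} {k : ℕ}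
    (hσ : sign σ = 1) (hτ : sign τ = 1) (h : τ * σ ^ k * τ⁻¹ = σ') {v : V} {l : K}
    (hv : oddLift T σ v = l • v) : oddLift T σ' (T τ v) = l ^ k • T τ v := by
  have h1 := LinearMap.congr_fun (hT.conj (σ := σ ^ k) (by simp [hσ]) hτ) v
  rw [h, hT.oddLift_pow hσ] at h1
  have h2 : ∀ k : ℕ, (oddLift T σ ^ k) v = l ^ k • v := fun k => by
    induction k with
    | zero => simp
    | succ k ih => rw [pow_succ', Module.End.mul_apply, ih, map_smul, hv, smul_smul, pow_succ]
  rw [Module.End.mul_apply, Module.End.mul_apply, h2, map_smul] at h1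
  exact h1.symm

theorem finrank_eigenspace_le_pow [FiniteDimensional K V] {T : Perm α → End K V}
    (hT : IsSignedHom T) {σ τ : Perm α} {k : ℕ} (hσ : sign σ = 1) (hτ : sign τ = 1)
    (h : τ * σ ^ k * τ⁻¹ = σ) (l : K) :
    finrank K ((oddLift T σ).eigenspace l) ≤ finrank K ((oddLift T σ).eigenspace (l ^ k)) := by
  refine LinearMap.finrank_le_finrank_of_injective (f := (T τ).restrict fun v hv => ?_) ?_
  · rw [Module.End.mem_eigenspace_iff] at hv ⊢
    exact hT.oddLift_apply_conj hσ hτ h hv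
  · rw [← LinearMap.ker_eq_bot, LinearMap.ker_eq_bot']
    intro v hv
    exact Subtype.ext (hT.apply_eq_zero hτ (congrArg Subtype.val hv))

theorem oddLift_commute {R : Type*} [Ring R] {T : Perm α → R} (hT : IsSignedHom T) {σ τ : Perm α}
    (hσ : sign σ = 1) (hτ : sign τ = 1) (h : Commute τ σ) : Commute (T τ) (oddLift T σ) := by
  have := hT.conj hσ hτ
  rwa [h.eq, mul_inv_cancel_right] at this

end IsSignedHom

theorem exists_iterate_eq (x y : ZMod 5 × ZMod 5) (hx : x.1 ≠ 0 ∧ x.2 ≠ 0)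
    (hy : y.1 ≠ 0 ∧ y.2 ≠ 0) : ∃ (i : Fin 8) (j : Fin 2),
      (fun x : ZMod 5 × ZMod 5 => (x.2 * 2, x.1))^[i]
        ((fun x : ZMod 5 × ZMod 5 => (x.1 * 4, x.2))^[j] x) = y := by
  revert x y
  decide +kernel

theorem pow_mul_val {K : Type*} [Field K] {l : K} (hl : l ^ 5 = 1) (x : ZMod 5) (k : ℕ) :
    (l ^ x.val) ^ k = l ^ (x * k).val := by
  rw [← pow_mul, ← ZMod.natCast_zmod_val x, ← Nat.cast_mul, ZMod.val_natCast, ZMod.val_natCast,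
    Nat.mod_eq_of_lt (ZMod.val_lt x), ← Nat.div_add_mod (x.val * k) 5, pow_add, pow_mul, hl,
    one_pow, one_mul, Nat.mul_add_mod, Nat.mod_mod]

namespace IsSignedHom

variable {K V : Type*} [Field K] [AddCommGroup V] [Module K V]

theorem exists_eigenvector_of_exists [CharZero K]
    {T : Perm (Fin 10) → End K V} (hT : IsSignedHom T) {l : K} (hl : l ^ 5 = 1)
    {x : ZMod 5 × ZMod 5} (hx : x.1 ≠ 0 ∧ x.2 ≠ 0)
    (h : ∃ v, v ≠ 0 ∧ oddLift T fiveCycleLeft v = l ^ x.1.val • v ∧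
      oddLift T fiveCycleRight v = l ^ x.2.val • v)
    {y : ZMod 5 × ZMod 5} (hy : y.1 ≠ 0 ∧ y.2 ≠ 0) :
    ∃ v, v ≠ 0 ∧ oddLift T fiveCycleLeft v = l ^ y.1.val • v ∧
      oddLift T fiveCycleRight v = l ^ y.2.val • v := by
  have hs : sign fiveCycleLeft = 1 := by decide +kernel
  have hs' : sign fiveCycleRight = 1 := by decide +kernel
  obtain ⟨i, j, rfl⟩ := exists_iterate_eq x y hx hy
  let P : ZMod 5 × ZMod 5 → Prop := fun y =>
    ∃ v, v ≠ 0 ∧ oddLift T fiveCycleLeft v = l ^ y.1.val • v ∧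
      oddLift T fiveCycleRight v = l ^ y.2.val • v
  have h1 : ∀ y, P y → P (y.2 * 2, y.1) := by
    rintro y ⟨v, hv0, hv, hv'⟩
    have hsign : sign ((swap 0 3 * swap 1 4 * swap 2 5 * swap 6 8 * swap 7 9) *
        List.formPerm [5, 4, 8, 9] : Perm (Fin 10)) = 1 := by decide +kernel
    refine ⟨_, fun h => hv0 (hT.apply_eq_zero hsign h), ?_, ?_⟩
    · rw [hT.oddLift_apply_conj (k := 2) hs' hsign (by decide +kernel) hv', pow_mul_val hl]
      rfl
    · rw [hT.oddLift_apply_conj (k := 1) hs hsign (by decide +kernel) hv, pow_one]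
  have h2 : ∀ y, P y → P (y.1 * 4, y.2) := by
    rintro y ⟨v, hv0, hv, hv'⟩
    have hsign : sign (swap 7 1 * swap 6 2 : Perm (Fin 10)) = 1 := by decide +kernel
    refine ⟨_, fun h => hv0 (hT.apply_eq_zero hsign h), ?_, ?_⟩
    · rw [hT.oddLift_apply_conj (k := 4) hs hsign (by decide +kernel) hv, pow_mul_val hl]
      rfl
    · rw [hT.oddLift_apply_conj (k := 1) hs' hsign (by decide +kernel) hv', pow_one]
  have hiter : ∀ f : ZMod 5 × ZMod 5 → ZMod 5 × ZMod 5, (∀ y, P y → P (f y)) →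
      ∀ (n : ℕ) y, P y → P (f^[n] y) := by
    intro f hf n
    induction n with
    | zero => exact fun _ => id
    | succ n ih => exact fun y hy => ih _ (hf y hy)
  exact hiter _ h1 _ _ (hiter _ h2 _ _ h)

theorem sixteen_le_finrank [CharZero K] [IsAlgClosed K] [FiniteDimensional K V]
    {T : Perm (Fin 10) → End K V} (hT : IsSignedHom T)
    (h : (oddLift T fiveCycleLeft - 1) * (oddLift T fiveCycleRight - 1) ≠ 0) :
    16 ≤ finrank K V := by
  have hs : sign fiveCycleLeft = 1 := by decide +kernel
  have hs' : sign fiveCycleRight = 1 := by decide +kernel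
  have hp : oddLift T fiveCycleLeft ^ 5 = 1 := hT.oddLift_pow_eq_one hs (by decide +kernel)
  have hq : oddLift T fiveCycleRight ^ 5 = 1 := hT.oddLift_pow_eq_one hs' (by decide +kernel)
  have hpq : Commute (oddLift T fiveCycleLeft) (oddLift T fiveCycleRight) :=
    (hT.oddLift_commute hs' hs (by unfold Commute SemiconjBy; decide +kernel)).pow_left 16
  obtain ⟨l, hl, hl1, v, hv, hqv⟩ := exists_eigenvector_of_mul_ne_zero hp hpq h
  have hmaps (l : K) : ∀ v ∈ (oddLift T fiveCycleLeft).eigenspace l,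
      oddLift T fiveCycleRight v ∈ (oddLift T fiveCycleLeft).eigenspace l :=
    Module.End.mapsTo_genEigenspace_of_comm hpq l 1
  let q (l : K) : End K ((oddLift T fiveCycleLeft).eigenspace l) :=
    (oddLift T fiveCycleRight).restrict (hmaps l)
  have hq5 : q l ^ 5 = 1 := by
    rw [Module.End.pow_restrict]
    ext v
    simp [hq]
  obtain ⟨r, hr, ⟨u, hu⟩, hru, hu1⟩ := exists_eigenvector_apply_ne_zero (X := q l - 1) hq5
    fun h0 => hqv (by
      have := congrArg Subtype.val (LinearMap.congr_fun h0 ⟨v, Module.End.mem_eigenspace_iff.2 hv⟩)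
      simpa [q, sub_eq_zero] using this)
  have hprim : IsPrimitiveRoot l 5 := by
    have : Fact (Nat.Prime 5) := ⟨by norm_num⟩
    exact IsPrimitiveRoot.iff_orderOf.2 (orderOf_eq_prime hl hl1)
  obtain ⟨m, hm, rfl⟩ := hprim.eq_pow_of_pow_eq_one hr
  have hm0 : m ≠ 0 := by
    rintro rfl
    rw [pow_zero, one_smul] at hru
    exact hu1 (by simp [hru])
  have hbase : ∃ v, v ≠ 0 ∧ oddLift T fiveCycleLeft v = l ^ (1 : ZMod 5).val • v ∧
      oddLift T fiveCycleRight v = l ^ (m : ZMod 5).val • v := by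
    refine ⟨u, ?_, ?_, ?_⟩
    · rintro rfl
      exact hu1 (map_zero (q l - 1))
    · rw [Module.End.mem_eigenspace_iff.1 hu]
      exact congrArg (· • u) (pow_one l).symm
    · rw [ZMod.val_natCast, Nat.mod_eq_of_lt hm]
      exact congrArg Subtype.val hru
  have hne : ∀ i : ℕ, ¬ 5 ∣ i → (i : ZMod 5) ≠ 0 := fun i hi h =>
    hi ((ZMod.natCast_eq_zero_iff i 5).1 h)
  have hval : ∀ i : ℕ, l ^ (i : ZMod 5).val = l ^ i := fun i => by
    rw [ZMod.val_natCast, ← pow_mod_orderOf l i, ← hprim.eq_orderOf]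
  refine four_mul_le_finrank (p := oddLift T fiveCycleLeft) (d := 4) hl hl1 fun i hi => ?_
  refine four_mul_le_finrank (p := q (l ^ i)) (d := 1) hl hl1 fun j hj => ?_
  obtain ⟨w, hw0, hw, hw'⟩ := hT.exists_eigenvector_of_exists hl (x := (1, (m : ZMod 5)))
    ⟨(by decide : (1 : ZMod 5) ≠ 0), hne m fun h => hm0 (Nat.eq_zero_of_dvd_of_lt h hm)⟩ hbase
    (y := ((i : ZMod 5), (j : ZMod 5))) ⟨hne i hi, hne j hj⟩
  simp only [hval] at hw hw'
  let w' : (oddLift T fiveCycleLeft).eigenspace (l ^ i) := ⟨w, Module.End.mem_eigenspace_iff.2 hw⟩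
  exact Module.finrank_pos_iff_exists_ne_zero.2
    ⟨⟨w', Module.End.mem_eigenspace_iff.2 (Subtype.ext hw')⟩,
      fun h => hw0 (congrArg Subtype.val (congrArg Subtype.val h))⟩

end IsSignedHom

theorem viaEmbedding_commute {α β γ : Type*} {f : α ↪ γ} {g : β ↪ γ}
    (h : ∀ x y, f x ≠ g y) (σ : Perm α) (τ : Perm β) :
    Commute (σ.viaEmbedding f) (τ.viaEmbedding g) := by
  refine Perm.Disjoint.commute fun z => ?_
  by_cases hz : z ∈ Set.range f
  · obtain ⟨x, rfl⟩ := hz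
    exact Or.inr (viaEmbedding_apply_of_notMem _ _ _ fun ⟨y, hy⟩ => h x y hy.symm)
  · exact Or.inl (viaEmbedding_apply_of_notMem _ _ _ hz)

namespace IsSignedHom

variable {α K V : Type*} [DecidableEq α] [Fintype α] [Field K] [AddCommGroup V] [Module K V]

/-- The restriction of the even permutations in a signed homomorphism to an invariant subspace. -/
theorem exists_restrict {T : Perm α → End K V} (hT : IsSignedHom T) {E : Submodule K V}
    (hE : ∀ σ, sign σ = 1 → ∀ v ∈ E, T σ v ∈ E) :
    ∃ T' : Perm α → End K E, IsSignedHom T' ∧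
      ∀ σ, sign σ = 1 → ∀ v : E, (T' σ v : V) = T σ v := by
  let T' : Perm α → End K E := fun σ => if h : sign σ = 1 then (T σ).restrict (hE σ h) else 0
  have hT' : ∀ σ, sign σ = 1 → ∀ v : E, (T' σ v : V) = T σ v := fun σ h v => by
    simp only [T', dif_pos h, LinearMap.restrict_apply]
  refine ⟨T', ⟨?_, fun σ τ hσ hτ => ?_⟩, hT'⟩
  · rcases hT.one with h | h
    · exact Or.inl (LinearMap.ext fun v => Subtype.ext (by rw [hT' 1 (by simp), h]; rfl))
    · exact Or.inr (LinearMap.ext fun v => Subtype.ext (by rw [hT' 1 (by simp), h]; rfl))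
  · rcases hT.mul σ τ hσ hτ with h | h
    · refine Or.inl (LinearMap.ext fun v => Subtype.ext ?_)
      rw [hT' _ (by simp [hσ, hτ]), h, Module.End.mul_apply, Module.End.mul_apply, hT' σ hσ,
        hT' τ hτ]
    · refine Or.inr (LinearMap.ext fun v => Subtype.ext ?_)
      rw [hT' _ (by simp [hσ, hτ]), h, LinearMap.neg_apply, LinearMap.neg_apply,
        Module.End.mul_apply, Module.End.mul_apply, Submodule.coe_neg, hT' σ hσ, hT' τ hτ]

theorem card_sub_le_finrank_of_induction [CharZero K] [IsAlgClosed K] [FiniteDimensional K V]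
    {T : Perm α → End K V} (hT : IsSignedHom T) (f : Fin 10 ↪ α)
    (h : (oddLift T (fiveCycleLeft.viaEmbedding f) - 1) *
      (oddLift T (fiveCycleRight.viaEmbedding f) - 1) ≠ 0)
    (ih : ∀ (E : Submodule K V) (β : Finset α) (T' : Perm β → End K E), β.card + 5 = Fintype.card α →
      IsSignedHom T' → (∃ g : Fin 5 ↪ β, oddLift T' ((finRotate 5).viaEmbedding g) ≠ 1) →
      β.card ≤ finrank K E + 1) :
    4 * (Fintype.card α - 6) ≤ finrank K V := by
  let a : Fin 5 ↪ Fin 10 := ⟨![0, 1, 2, 6, 7], by decide⟩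
  let b : Fin 5 ↪ Fin 10 := ⟨![3, 4, 5, 8, 9], by decide⟩
  have ha : fiveCycleLeft = (finRotate 5).viaEmbedding a :=
    viaEmbedding_unique (by decide +kernel) (by
      simp only [Set.mem_range]; decide +kernel)
  have hb : fiveCycleRight = (finRotate 5).viaEmbedding b :=
    viaEmbedding_unique (by decide +kernel) (by
      simp only [Set.mem_range]; decide +kernel)
  have hab : ∀ x y, a x ≠ b y := by decide +kernel
  have hs : sign (fiveCycleLeft.viaEmbedding f) = 1 := by
    rw [sign_viaEmbedding]; decide +kernel
  have hs' : sign (fiveCycleRight.viaEmbedding f) = 1 := by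
    rw [sign_viaEmbedding]; decide +kernel
  have hp : oddLift T (fiveCycleLeft.viaEmbedding f) ^ 5 = 1 := by
    refine hT.oddLift_pow_eq_one hs ?_
    change viaEmbeddingHom f fiveCycleLeft ^ 5 = 1
    rw [← map_pow, show fiveCycleLeft ^ 5 = 1 by decide +kernel, map_one]
  set p := oddLift T (fiveCycleLeft.viaEmbedding f) with hpdef
  let β : Finset α := Finset.univ.filter fun x => x ∉ Set.range (a.trans f)
  have hβ : ∀ x (y : β), (a.trans f) x ≠ y := fun x y h => by
    have := y.2
    simp only [β, Finset.mem_filter] at this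
    exact this.2 ⟨x, h⟩
  have hβcard : β.card + 5 = Fintype.card α := by
    have h5 : β = (Finset.univ.map (a.trans f))ᶜ := by
      ext x
      simp [β]
    have hle := Finset.card_le_univ (Finset.univ.map (a.trans f))
    rw [Finset.card_map, Finset.card_univ, Fintype.card_fin] at hle
    rw [h5, Finset.card_compl, Finset.card_map, Finset.card_univ, Fintype.card_fin]
    omega
  let g : Fin 5 ↪ β := ⟨fun x => ⟨f (b x), by
    simp only [β, Finset.mem_filter, Finset.mem_univ, true_and]
    rintro ⟨y, hy⟩
    exact hab y x (f.injective hy)⟩, fun x y hxy =>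
      b.injective (f.injective (congrArg Subtype.val hxy))⟩
  let ι : β ↪ α := Function.Embedding.subtype _
  have hg : g.trans ι = b.trans f := rfl
  have hcomm : ∀ σ : Perm β, sign σ = 1 → Commute p (T (σ.viaEmbedding ι)) := fun σ hσ => by
    refine (hT.oddLift_commute hs (by rw [sign_viaEmbedding, hσ]) ?_).symm
    rw [ha, viaEmbedding_trans]
    exact (viaEmbedding_commute hβ _ _).symm
  have hpq : Commute p (oddLift T (fiveCycleRight.viaEmbedding f)) := by
    have := (hcomm ((finRotate 5).viaEmbedding g) (by
      rw [sign_viaEmbedding]; decide +kernel)).pow_right 16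
    rwa [viaEmbedding_trans, hg, ← viaEmbedding_trans, ← hb] at this
  obtain ⟨l, hl, hl1, v, hv, hqv⟩ := exists_eigenvector_of_mul_ne_zero hp hpq h
  obtain ⟨T', hT', hT'v⟩ := (hT.viaEmbedding ι).exists_restrict (E := p.eigenspace l) fun σ hσ =>
    Module.End.mapsTo_genEigenspace_of_comm (hcomm σ hσ) l 1
  have hE := ih _ β T' hβcard hT' ⟨g, fun h1 => hqv ?_⟩
  · refine four_mul_le_finrank hl hl1 (p := p) fun i hi => ?_
    obtain ⟨τ, hτ, hτ'⟩ := exists_sign_eq_one_conj_fiveCycleLeft_pow hi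
    have hle := hT.finrank_eigenspace_le_pow (σ := fiveCycleLeft.viaEmbedding f)
      (τ := τ.viaEmbedding f) (k := i) hs (by rw [sign_viaEmbedding, hτ]) (by
        change viaEmbeddingHom f τ * viaEmbeddingHom f fiveCycleLeft ^ i *
          (viaEmbeddingHom f τ)⁻¹ = viaEmbeddingHom f fiveCycleLeft
        rw [← map_pow, ← map_mul, ← map_inv, ← map_mul, hτ']) l
    rw [← hpdef] at hle
    omega
  · have h2 := congrArg Subtype.val (LinearMap.congr_fun h1 ⟨v, Module.End.mem_eigenspace_iff.2 hv⟩)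
    have h3 : ∀ (k : ℕ) (w : p.eigenspace l), (((T' ((finRotate 5).viaEmbedding g) ^ k) w :
        p.eigenspace l) : V) = (T (fiveCycleRight.viaEmbedding f) ^ k) w := by
      intro k w
      induction k with
      | zero => rfl
      | succ k ih =>
        rw [pow_succ', pow_succ', Module.End.mul_apply, Module.End.mul_apply, ← ih, hT'v _ (by
          rw [sign_viaEmbedding]; decide +kernel), viaEmbedding_trans, hg, ← viaEmbedding_trans,
          ← hb]
    rw [oddLift, h3] at h2
    exact h2

theorem card_le_finrank_add_one {K : Type} [Field K] [CharZero K] [IsAlgClosed K] :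
    ∀ (n : ℕ) {α V : Type} [DecidableEq α] [Fintype α] [AddCommGroup V] [Module K V]
      [FiniteDimensional K V] {T : Perm α → End K V}, Fintype.card α = n → 10 ≤ n →
      IsSignedHom T → (∃ g : Fin 5 ↪ α, oddLift T ((finRotate 5).viaEmbedding g) ≠ 1) →
      n ≤ finrank K V + 1 := by
  intro n
  induction n using Nat.strong_induction_on with
  | _ n ih =>
    intro α V _ _ _ _ _ T hα hn hT hg
    by_cases h : ∀ f : Fin 10 ↪ α, (oddLift T (fiveCycleLeft.viaEmbedding f) - 1) *
      (oddLift T (fiveCycleRight.viaEmbedding f) - 1) = 0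
    · rw [← hα]
      exact (hT.isThreeCycleSystem (by omega) hg h).card_le_finrank_add_one (by omega)
    · push Not at h
      obtain ⟨f, hf⟩ := h
      by_cases h15 : n < 15
      · have := (hT.viaEmbedding f).sixteen_le_finrank hf
        omega
      · have := hT.card_sub_le_finrank_of_induction f hf fun E β T' hβ hT' hg' =>
          ih β.card (by omega) (by simp) (by omega) hT' hg'
        omega

end IsSignedHom

theorem eq_one_or_forall_apply_eq_neg_of_mem_center {F G V : Type*} [Field F] [Group G]
    [AddCommGroup V] [Module F V] (ρ : G →* (V ≃ₗ[F] V))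
    (hirr : ∀ W : Submodule F V, (∀ g : G, ∀ v ∈ W, ρ g v ∈ W) → W = ⊥ ∨ W = ⊤)
    {k : G} (hk : k ∈ Subgroup.center G) (hk2 : k * k = 1) :
    (∀ v, ρ k v = v) ∨ ∀ v, ρ k v = -v := by
  have hkk : ∀ v, ρ k (ρ k v) = v := fun v => by
    rw [← LinearEquiv.mul_apply, ← map_mul, hk2, map_one]
    rfl
  have hinv : ∀ g : G, ∀ v ∈ LinearMap.ker ((ρ k).toLinearMap - 1),
      ρ g v ∈ LinearMap.ker ((ρ k).toLinearMap - 1) := fun g v hv => by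
    simp only [LinearMap.mem_ker, LinearMap.sub_apply, LinearEquiv.coe_coe, Module.End.one_apply,
      sub_eq_zero] at hv ⊢
    rw [← LinearEquiv.mul_apply, ← map_mul, ← Subgroup.mem_center_iff.mp hk g, map_mul,
      LinearEquiv.mul_apply, hv]
  rcases hirr _ hinv with h | h
  · refine Or.inr fun v => eq_neg_of_add_eq_zero_left ?_
    rw [← Submodule.mem_bot F, ← h, LinearMap.mem_ker]
    simp [hkk, add_comm]
  · refine Or.inl fun v => ?_
    have hv : v ∈ LinearMap.ker ((ρ k).toLinearMap - 1) := h ▸ Submodule.mem_top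
    simpa [sub_eq_zero] using hv

theorem exists_isSignedHom {n : ℕ} (h5 : 5 ≤ n) {G R : Type*} [Group G] [Ring R]
    {π : G →* alternatingGroup (Fin n)} (hsurj : Function.Surjective π)
    {Φ : G →* R} (hΦ : Function.Injective Φ) (hker : ∀ k ∈ π.ker, Φ k = 1 ∨ Φ k = -1) :
    ∃ T : Perm (Fin n) → R, IsSignedHom T ∧
      ∃ g : Fin 5 ↪ Fin n, oddLift T ((finRotate 5).viaEmbedding g) ≠ 1 := by
  choose s hs using hsurj
  have hΦs : ∀ g g', π g = π g' → Φ g = Φ g' ∨ Φ g = -Φ g' := fun g g' h => by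
    have := hker (g'⁻¹ * g) (by simp [MonoidHom.mem_ker, h])
    rw [show Φ g = Φ g' * Φ (g'⁻¹ * g) by rw [← map_mul, mul_inv_cancel_left]]
    exact this.imp (fun h => by rw [h, mul_one]) fun h => by rw [h, mul_neg, mul_one]
  let T : Perm (Fin n) → R := fun σ =>
    if h : sign σ = 1 then Φ (s ⟨σ, mem_alternatingGroup.mpr h⟩) else 0
  have hT : ∀ σ (h : sign σ = 1), T σ = Φ (s ⟨σ, mem_alternatingGroup.mpr h⟩) :=
    fun σ h => dif_pos h
  refine ⟨T, ⟨?_, fun σ τ hσ hτ => ?_⟩, Fin.castLEEmb h5, fun h => ?_⟩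
  · rw [← map_one Φ, hT 1 Perm.sign_one]
    exact hΦs _ _ ((hs _).trans (map_one π).symm)
  · have hστ : sign (σ * τ) = 1 := by simp [hσ, hτ]
    rw [hT σ hσ, hT τ hτ, hT _ hστ, ← map_mul Φ]
    exact hΦs _ _ (by rw [map_mul π, hs, hs, hs]; rfl)
  · have hsign : sign ((finRotate 5).viaEmbedding (Fin.castLEEmb h5)) = 1 := by
      rw [sign_viaEmbedding]
      decide +kernel
    rw [oddLift, hT _ hsign, ← map_pow, ← map_one Φ] at h
    have h16 := congrArg (fun g => (π g : Perm (Fin n))) (hΦ h)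
    simp only [map_pow, hs, map_one, SubgroupClass.coe_pow, OneMemClass.coe_one] at h16
    change viaEmbeddingHom _ (finRotate 5) ^ 16 = 1 at h16
    rw [← map_pow, map_eq_one_iff _ (viaEmbeddingHom_injective _)] at h16
    exact absurd h16 (by decide +kernel)

theorem le_finrank_add_one_of_faithful {n : ℕ} (h10 : 10 ≤ n) {G : Type} [Group G]
    (π : G →* alternatingGroup (Fin n)) (hsurj : Function.Surjective π)
    (hcentral : π.ker ≤ Subgroup.center G) (hker2 : Nat.card π.ker = 2)
    {F : Type} [Field F] [CharZero F]
    {V : Type} [AddCommGroup V] [Module F V] [FiniteDimensional F V]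
    (ρ : G →* (V ≃ₗ[F] V)) (hfaithful : Function.Injective ρ)
    (hirr : ∀ W : Submodule F V, (∀ g : G, ∀ v ∈ W, ρ g v ∈ W) → W = ⊥ ∨ W = ⊤) :
    n ≤ finrank F V + 1 := by
  let K := AlgebraicClosure F
  let Φ : G →* End K (TensorProduct F K V) :=
    ((Module.End.baseChangeHom F K V : End F V →* End K (TensorProduct F K V)).comp
      (LinearEquiv.automorphismGroup.toLinearMapMonoidHom)).comp ρ
  have hΦ : ∀ g v, Φ g (1 ⊗ₜ v) = 1 ⊗ₜ ρ g v := fun g v =>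
    LinearMap.baseChange_tmul (f := (ρ g).toLinearMap) 1 v
  have hΦinj : Function.Injective Φ := fun g g' h => hfaithful <| LinearEquiv.ext fun v => by
    have := LinearMap.congr_fun h (1 ⊗ₜ v)
    rw [hΦ, hΦ] at this
    exact Module.FaithfullyFlat.tensorProduct_mk_injective (B := K) V this
  have hker : ∀ k ∈ π.ker, Φ k = 1 ∨ Φ k = -1 := fun k hk => by
    have hk2 : k * k = 1 := by
      have := pow_card_eq_one' (x := (⟨k, hk⟩ : π.ker))
      rw [hker2, pow_two] at this
      exact congrArg Subtype.val this
    refine (eq_one_or_forall_apply_eq_neg_of_mem_center ρ hirr (hcentral hk) hk2).imp ?_ ?_ <;>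
    · intro h
      ext v
      simp [hΦ, h, TensorProduct.tmul_neg]
  obtain ⟨T, hT, hT'⟩ := exists_isSignedHom (R := End K (TensorProduct F K V)) (Φ := Φ)
    (by omega) hsurj hΦinj hker
  rw [← Module.finrank_baseChange (R := K)]
  exact hT.card_le_finrank_add_one n (Fintype.card_fin n) h10 hT'

end

/-- Let `n ≥ 10` be an even integer, `G'` a finite group with a surjective homomorphism
`π : G' → A_n` whose kernel is a central subgroup of order `2`, and `F` a field of
characteristic `0`.  Then every faithful irreducible finite-dimensional representation
of `G'` over `F` has dimension different from `n - 2`. -/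
theorem stmt_2 (n : ℕ) (hn : Even n) (h10 : 10 ≤ n)
    (G' : Type) [Group G'] [Finite G']
    (π : G' →* alternatingGroup (Fin n)) (hsurj : Function.Surjective π)
    (hcentral : π.ker ≤ Subgroup.center G') (hker2 : Nat.card π.ker = 2)
    (F : Type) [Field F] [CharZero F]
    (V : Type) [AddCommGroup V] [Module F V] [FiniteDimensional F V]
    (ρ : G' →* (V ≃ₗ[F] V))
    (hfaithful : Function.Injective ρ)
    (hV : Nontrivial V)
    (hirr : ∀ W : Submodule F V, (∀ g : G', ∀ v ∈ W, ρ g v ∈ W) → W = ⊥ ∨ W = ⊤) :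
    Module.finrank F V ≠ n - 2 := by
  intro h
  have := le_finrank_add_one_of_faithful h10 π hsurj hcentral hker2 ρ hfaithful hirr
  omega
end
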